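/- arXiv:2309.05199 — 3 statements merged into one kernel-verified Lean document; each statement's English description precedes it below -/
import Mathlib

section
/- If G is a (4K₁, co-(P₃∪P₂))-free graph with clique number ω, then χ(G) ≤ 4ω. -/
open SimpleGraph

/-- `G` contains `H`, i.e. `H` is isomorphic to an induced subgraph of `G`. -/
def Contains {V W : Type*} (G : SimpleGraph V) (H : SimpleGraph W) : Prop :=
  Nonempty (H ↪g G)

/-- The path `P₃` on 3 vertices. -/
def P3 : SimpleGraph (Fin 3) := fromEdgeSet {s(0,1), s(1,2)}

/-- The disjoint union `P₃ ∪ P₂` on 5 vertices. -/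
def P3P2 : SimpleGraph (Fin 5) := fromEdgeSet {s(0,1), s(1,2), s(3,4)}

/-- The disjoint union `K₃ ∪ P₂` on 5 vertices. -/
def K3P2 : SimpleGraph (Fin 5) := fromEdgeSet {s(0,1), s(0,2), s(1,2), s(3,4)}

/-- co-domino: the 6-cycle u₁v₁v₂v₃u₃u₂ (vertices 0 1 2 3 4 5) plus the edges
v₁v₃ and u₁u₃. -/
def coDomino : SimpleGraph (Fin 6) :=
  fromEdgeSet {s(0,1), s(1,2), s(2,3), s(3,4), s(4,5), s(5,0), s(1,3), s(0,4)}

/-- co-A: the 6-cycle u₁v₁v₂v₃u₃u₂ (vertices 0 1 2 3 4 5) plus the edges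
v₁v₃, u₁u₃ and u₁v₃. -/
def coA : SimpleGraph (Fin 6) :=
  fromEdgeSet {s(0,1), s(1,2), s(2,3), s(3,4), s(4,5), s(5,0), s(1,3), s(0,4), s(0,3)}

/-- χ37: the 6-cycle u₁v₁v₂v₃u₃u₂ (vertices 0 1 2 3 4 5) plus the single edge v₁v₃. -/
def chi37 : SimpleGraph (Fin 6) :=
  fromEdgeSet {s(0,1), s(1,2), s(2,3), s(3,4), s(4,5), s(5,0), s(1,3)}

/-- X₁: the 6-cycle v₁v₂v₃u₃u₂u₁ (vertices 0 1 2 3 4 5) plus the edge v₁v₃,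
together with a new vertex u = 6 and the edges uv₁ and uu₂. -/
def X1 : SimpleGraph (Fin 7) :=
  fromEdgeSet {s(0,1), s(1,2), s(2,3), s(3,4), s(4,5), s(5,0), s(0,2), s(6,0), s(6,4)}

/-- X₂: the 6-cycle v₁v₂v₃u₃u₂u₁ (vertices 0 1 2 3 4 5) plus the edges v₁v₃, v₃u₁, u₁u₃,
together with a new vertex u = 6 and the edges uv₂ and uu₂. -/
def X2 : SimpleGraph (Fin 7) :=
  fromEdgeSet {s(0,1), s(1,2), s(2,3), s(3,4), s(4,5), s(5,0), s(0,2), s(2,5), s(3,5),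
    s(6,1), s(6,4)}

/-- co-twin-C₅: the 5-cycle v₁v₂v₃v₄v₅ (vertices 0 1 2 3 4) plus a new vertex v₆ = 5
adjacent exactly to v₃, v₄ and v₅. -/
def coTwinC5 : SimpleGraph (Fin 6) :=
  fromEdgeSet {s(0,1), s(1,2), s(2,3), s(3,4), s(4,0), s(2,5), s(3,5), s(4,5)}

/-- `D₁ = {x : ω(G − N(x)) ≤ 2}`, where `G − N(x)` is the subgraph induced on the
vertices not adjacent to `x` (including `x` itself). -/
def D1 {V : Type*} (G : SimpleGraph V) : Set V :=
  {x : V | (G.induce {y : V | ¬ G.Adj x y}).cliqueNum ≤ 2}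

/-- `M(v)`: the set of vertices distinct from `v` and nonadjacent to `v`. -/
def Mset {V : Type*} (G : SimpleGraph V) (v : V) : Set V :=
  {u : V | u ≠ v ∧ ¬ G.Adj v u}

section CliqueCover

variable {V : Type*} {H : SimpleGraph V}

/-- The vertices of `S` can be partitioned into at most `n` cliques of `H`. -/
def CliqueCover (H : SimpleGraph V) (S : Finset V) (n : ℕ) : Prop :=
  ∃ f : V → ℕ, (∀ x ∈ S, f x < n) ∧ ∀ x ∈ S, ∀ y ∈ S, f x = f y → x ≠ y → H.Adj x y

/-- No two vertices of `S` are adjacent in `H`. -/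
def Independent (H : SimpleGraph V) (S : Finset V) : Prop :=
  ∀ x ∈ S, ∀ y ∈ S, ¬ H.Adj x y

/-- Adjacency restricted to `S` is transitive, that is, `S` induces no path on three vertices. -/
def InducesNoP3 (H : SimpleGraph V) (S : Finset V) : Prop :=
  ∀ x ∈ S, ∀ y ∈ S, ∀ z ∈ S, H.Adj x y → H.Adj y z → x ≠ z → H.Adj x z

/-- `H` has no induced `P₃ ∪ P₂`. -/
def NoP3P2 (H : SimpleGraph V) : Prop :=
  ∀ a b c d e, H.Adj a b → H.Adj b c → a ≠ c → ¬ H.Adj a c → H.Adj d e →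
    ¬ H.Adj a d → ¬ H.Adj a e → ¬ H.Adj b d → ¬ H.Adj b e → ¬ H.Adj c d → ¬ H.Adj c e → False

/-- `H` has no four pairwise adjacent vertices. -/
def NoK4 (H : SimpleGraph V) : Prop :=
  ∀ a b c d, H.Adj a b → H.Adj a c → H.Adj a d → H.Adj b c → H.Adj b d → H.Adj c d → False

/-- The pairs `p i`, `q i` for `i ∈ Y` are the edges of an induced matching of `H` in `A`. -/
structure IsInducedMatching (H : SimpleGraph V) (A Y : Finset V) (p q : V → V) : Prop where
  left_mem : ∀ i ∈ Y, p i ∈ A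
  right_mem : ∀ i ∈ Y, q i ∈ A
  adj : ∀ i ∈ Y, H.Adj (p i) (q i)
  left_left : ∀ i ∈ Y, ∀ j ∈ Y, i ≠ j → ¬ H.Adj (p i) (p j)
  left_right : ∀ i ∈ Y, ∀ j ∈ Y, i ≠ j → ¬ H.Adj (p i) (q j)
  right_right : ∀ i ∈ Y, ∀ j ∈ Y, i ≠ j → ¬ H.Adj (q i) (q j)

theorem CliqueCover.mono {S T : Finset V} {m n : ℕ} (h : CliqueCover H T n) (hS : S ⊆ T)
    (hn : n ≤ m) : CliqueCover H S m := by
  obtain ⟨f, h1, h2⟩ := h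
  exact ⟨f, fun x hx => (h1 x (hS hx)).trans_le hn, fun x hx y hy => h2 x (hS hx) y (hS hy)⟩

theorem CliqueCover.union [DecidableEq V] {S T : Finset V} {m n : ℕ} (hS : CliqueCover H S m)
    (hT : CliqueCover H T n) : CliqueCover H (S ∪ T) (m + n) := by
  obtain ⟨f, f1, f2⟩ := hS
  obtain ⟨g, g1, g2⟩ := hT
  refine ⟨fun x => if x ∈ S then f x else m + g x, ?_, ?_⟩
  · intro x hx
    grind
  · intro x hx y hy hxy hne
    grind

theorem cliqueCover_one {S : Finset V} (h : ∀ x ∈ S, ∀ y ∈ S, x ≠ y → H.Adj x y) :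
    CliqueCover H S 1 :=
  ⟨fun _ => 0, fun _ _ => one_pos, fun x hx y hy _ hne => h x hx y hy hne⟩

theorem cliqueCover_of_mapsTo {S T : Finset V} (f : V → V) (hf : ∀ x ∈ S, f x ∈ T)
    (h : ∀ x ∈ S, ∀ y ∈ S, f x = f y → x ≠ y → H.Adj x y) : CliqueCover H S T.card := by
  classical
  refine ⟨fun x => if hx : f x ∈ T then T.equivFin ⟨f x, hx⟩ else 0, ?_, ?_⟩
  · intro x hx
    simp [hf x hx]
  · intro x hx y hy hxy hne
    simp only [hf x hx, hf y hy, dite_true, Fin.val_inj, EmbeddingLike.apply_eq_iff_eq,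
      Subtype.mk.injEq] at hxy
    exact h x hx y hy hxy hne

theorem InducesNoP3.exists_cliqueCover [DecidableEq V] {S : Finset V} (hS : InducesNoP3 H S) :
    ∃ I ⊆ S, Independent H I ∧ CliqueCover H S I.card := by
  classical
  induction S using Finset.strongInduction with
  | H S ih =>
    rcases S.eq_empty_or_nonempty with rfl | ⟨x, hx⟩
    · exact ⟨∅, by simp, by simp [Independent], fun _ => 0, by simp, by simp⟩
    have hsub : S.filter (fun y => y ≠ x ∧ ¬ H.Adj x y) ⊂ S :=
      Finset.filter_ssubset.2 ⟨x, hx, by simp⟩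
    obtain ⟨I, hI, hind, hcov⟩ := ih _ hsub fun a ha b hb c hc =>
      hS a (hsub.1 ha) b (hsub.1 hb) c (hsub.1 hc)
    have hxI : x ∉ I := fun h => by simpa using hI h
    refine ⟨insert x I, ?_, ?_, ?_⟩
    · intro y hy
      rcases Finset.mem_insert.1 hy with rfl | hy
      · exact hx
      · exact hsub.1 (hI hy)
    · have : ∀ y ∈ I, ¬ H.Adj x y := fun y hy => (Finset.mem_filter.1 (hI hy)).2.2
      intro a ha b hb hab
      rcases Finset.mem_insert.1 ha with rfl | ha' <;>
        rcases Finset.mem_insert.1 hb with rfl | hb'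
      · exact hab.ne rfl
      · exact this b hb' hab
      · exact this a ha' hab.symm
      · exact hind a ha' b hb' hab
    · rw [Finset.card_insert_of_notMem hxI]
      refine (hcov.union (cliqueCover_one (S := S.filter fun y => y = x ∨ H.Adj x y) ?_)).mono
        ?_ le_rfl
      · intro a ha b hb hne
        simp only [Finset.mem_filter] at ha hb
        rcases ha.2 with rfl | ha' <;> rcases hb.2 with rfl | hb'
        · exact absurd rfl hne
        · exact hb'
        · exact ha'.symm
        · exact hS a ha.1 x hx b hb.1 ha'.symm hb' hne
      · intro a ha
        simp only [Finset.mem_union, Finset.mem_filter]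
        tauto

theorem cliqueCover_half [DecidableEq V] {α : ℕ} (hα : ∀ I, Independent H I → I.card ≤ α)
    (S : Finset V) : CliqueCover H S ((S.card + α) / 2) := by
  induction S using Finset.strongInduction with
  | H S ih =>
    by_cases hS : Independent H S
    · have := hα S hS
      exact (cliqueCover_of_mapsTo (T := S) id (fun x hx => hx)
        (fun x _ y _ h hne => absurd h hne)).mono subset_rfl (by omega)
    · simp only [Independent, not_forall, not_not] at hS
      obtain ⟨x, hx, y, hy, hxy⟩ := hS
      have hsub : {x, y} ⊆ S := by simp [Finset.insert_subset_iff, hx, hy]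
      have hcard := Finset.card_sdiff_add_card_eq_card hsub
      rw [Finset.card_pair hxy.ne] at hcard
      have hcov := ih (S \ {x, y}) (Finset.ssubset_iff_subset_ne.2
        ⟨Finset.sdiff_subset, fun h => by rw [h] at hcard; omega⟩)
      refine (hcov.union (cliqueCover_one (S := {x, y}) ?_)).mono
        (by rw [Finset.sdiff_union_of_subset hsub]) (by omega)
      intro a ha b hb hne
      have := hxy.symm
      grind

/-- The matching half of König's theorem: a maximum independent set of `I ∪ J` can be matched to
the part of `I` outside of it. -/
theorem exists_matching_into_maximum [DecidableEq V] {I J S : Finset V} (hI : Independent H I)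
    (hSsub : S ⊆ I ∪ J) (hS : Independent H S)
    (hmax : ∀ T ⊆ I ∪ J, Independent H T → T.card ≤ S.card) :
    ∃ f : V → V, ∀ x ∈ I \ S, f x ∈ S ∧ f x ∈ J ∧ H.Adj x (f x) ∧
      ∀ y ∈ I \ S, f x = f y → x = y := by
  classical
  let t : {x // x ∈ I \ S} → Finset V := fun x => (S ∩ J).filter (H.Adj x)
  have hall : ∀ X : Finset {x // x ∈ I \ S}, X.card ≤ (X.biUnion t).card := by
    intro X
    have hN : X.biUnion t ⊆ S := by
      intro y hy
      simp only [t, Finset.mem_biUnion, Finset.mem_filter, Finset.mem_inter] at hy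
      obtain ⟨_, _, h, _⟩ := hy
      exact h.1
    have hX : X.map (Function.Embedding.subtype _) ⊆ I \ S := by
      intro y hy
      simp only [Finset.mem_map] at hy
      obtain ⟨a, _, rfl⟩ := hy
      exact a.2
    have hdisj : Disjoint (S \ X.biUnion t) (X.map (Function.Embedding.subtype _)) := by
      rw [Finset.disjoint_left]
      intro a ha hb
      exact (Finset.mem_sdiff.1 (hX hb)).2 (Finset.mem_sdiff.1 ha).1
    have hcross : ∀ a ∈ S \ X.biUnion t, ∀ b ∈ X.map (Function.Embedding.subtype _),
        ¬ H.Adj b a := by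
      intro a ha b hb hab
      obtain ⟨haS, hat⟩ := Finset.mem_sdiff.1 ha
      obtain ⟨b', hb', rfl⟩ := Finset.mem_map.1 hb
      rcases Finset.mem_union.1 (hSsub haS) with haI | haJ
      · exact hI _ (Finset.mem_sdiff.1 b'.2).1 _ haI hab
      · exact hat (Finset.mem_biUnion.2 ⟨b', hb', Finset.mem_filter.2
          ⟨Finset.mem_inter.2 ⟨haS, haJ⟩, hab⟩⟩)
    have hle := hmax ((S \ X.biUnion t) ∪ X.map (Function.Embedding.subtype _)) ?_ ?_
    · rw [Finset.card_union_of_disjoint hdisj, Finset.card_map] at hle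
      have := Finset.card_sdiff_add_card_eq_card hN
      omega
    · intro a ha
      rcases Finset.mem_union.1 ha with ha | ha
      · exact hSsub (Finset.mem_sdiff.1 ha).1
      · exact Finset.mem_union_left _ (Finset.mem_sdiff.1 (hX ha)).1
    · intro a ha b hb hab
      rcases Finset.mem_union.1 ha with ha | ha <;> rcases Finset.mem_union.1 hb with hb | hb
      · exact hS a (Finset.mem_sdiff.1 ha).1 b (Finset.mem_sdiff.1 hb).1 hab
      · exact hcross a ha b hb hab.symm
      · exact hcross b hb a ha hab
      · exact hI a (Finset.mem_sdiff.1 (hX ha)).1 b (Finset.mem_sdiff.1 (hX hb)).1 hab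
  obtain ⟨f, hinj, hf⟩ := (Finset.all_card_le_biUnion_card_iff_exists_injective t).1 hall
  refine ⟨fun x => if hx : x ∈ I \ S then f ⟨x, hx⟩ else x, fun x hx => ?_⟩
  have hfx := hf ⟨x, hx⟩
  simp only [t, Finset.mem_filter, Finset.mem_inter] at hfx
  simp only [hx, dite_true]
  refine ⟨hfx.1.1, hfx.1.2, hfx.2, fun y hy hxy => ?_⟩
  simp only [hy, dite_true] at hxy
  exact congrArg Subtype.val (hinj hxy)

/-- König's theorem: a bipartite graph has a cover by as many cliques as the largest
independent set has elements. -/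
theorem cliqueCover_of_bipartite [DecidableEq V] {α : ℕ}
    (hα : ∀ I, Independent H I → I.card ≤ α) {I J : Finset V} (hI : Independent H I)
    (hJ : Independent H J) : CliqueCover H (I ∪ J) α := by
  classical
  obtain ⟨S, hSmem, hSmax⟩ := Finset.exists_max_image
    ((I ∪ J).powerset.filter (Independent H)) Finset.card
    ⟨∅, by simp [Independent]⟩
  simp only [Finset.mem_filter, Finset.mem_powerset] at hSmem hSmax
  obtain ⟨hSsub, hS⟩ := hSmem
  obtain ⟨f, hf⟩ := exists_matching_into_maximum hI hSsub hS fun T h1 h2 => hSmax T ⟨h1, h2⟩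
  obtain ⟨g, hg⟩ := exists_matching_into_maximum (I := J) (J := I) hJ
    (by rwa [Finset.union_comm]) hS
    fun T h1 h2 => hSmax T ⟨by rwa [Finset.union_comm], h2⟩
  simp only [Finset.mem_sdiff] at hf hg
  refine (cliqueCover_of_mapsTo (T := S) (fun x => if x ∈ S then x else if x ∈ I then f x else g x)
    ?_ ?_).mono subset_rfl (hα S hS)
  · intro x hx
    grind
  · intro x hx y hy hxy hne
    simp only [Independent] at hI hJ
    have := @SimpleGraph.Adj.symm V H
    grind

/-- A triangle-free set inducing no `P₃` consists of an induced matching and isolated vertices. -/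
theorem InducesNoP3.exists_isInducedMatching [DecidableEq V] {A : Finset V}
    (hA : InducesNoP3 H A)
    (htri : ∀ x ∈ A, ∀ y ∈ A, ∀ z ∈ A, H.Adj x y → H.Adj x z → ¬ H.Adj y z) :
    ∃ (J Y : Finset V) (p q : V → V), J ⊆ A ∧ Independent H J ∧ A.card = J.card + Y.card ∧
      IsInducedMatching H A Y p q := by
  classical
  obtain ⟨J, hJmem, hJmax⟩ := Finset.exists_max_image
    (A.powerset.filter (Independent H)) Finset.card ⟨∅, by simp [Independent]⟩
  simp only [Finset.mem_filter, Finset.mem_powerset] at hJmem hJmax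
  obtain ⟨hJA, hJ⟩ := hJmem
  have hex : ∀ y, ∃ x, y ∈ A \ J → x ∈ J ∧ H.Adj x y := by
    intro y
    by_cases hy : y ∈ A \ J
    · by_contra hno
      simp only [hy, true_imp_iff, not_exists, not_and] at hno
      obtain ⟨hyA, hyJ⟩ := Finset.mem_sdiff.1 hy
      have := hJmax (insert y J) ⟨Finset.insert_subset hyA hJA, ?_⟩
      · rw [Finset.card_insert_of_notMem hyJ] at this
        omega
      · intro a ha b hb hab
        rcases Finset.mem_insert.1 ha with rfl | ha' <;>
        rcases Finset.mem_insert.1 hb with rfl | hb'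
        · exact hab.ne rfl
        · exact hno b hb' hab.symm
        · exact hno a ha' hab
        · exact hJ a ha' b hb' hab
    · exact ⟨y, fun h => absurd h hy⟩
  choose p hp using hex
  have huniq : ∀ y ∈ A \ J, ∀ x ∈ J, H.Adj x y → x = p y := by
    intro y hy x hx hxy
    by_contra hne
    exact hJ x hx _ (hp y hy).1 (hA x (hJA hx) y (Finset.mem_sdiff.1 hy).1 _ (hJA (hp y hy).1)
      hxy (hp y hy).2.symm hne)
  have hinj : ∀ y ∈ A \ J, ∀ z ∈ A \ J, y ≠ z → p y ≠ p z := by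
    intro y hy z hz hne h
    have h1 := (hp y hy).2
    have h2 := (hp z hz).2
    rw [← h] at h2
    have hyA := (Finset.mem_sdiff.1 hy).1
    have hzA := (Finset.mem_sdiff.1 hz).1
    have hpA := hJA (hp y hy).1
    exact htri _ hpA y hyA z hzA h1 h2 (hA y hyA _ hpA z hzA h1.symm h2 hne)
  refine ⟨J, A \ J, p, id, hJA, hJ, ?_, ?_⟩
  · have := Finset.card_sdiff_add_card_eq_card hJA
    omega
  · refine ⟨fun i hi => hJA (hp i hi).1, fun i hi => (Finset.mem_sdiff.1 hi).1,
      fun i hi => (hp i hi).2, fun i hi j hj _ => hJ _ (hp i hi).1 _ (hp j hj).1,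
      fun i hi j hj hne h => hinj i hi j hj hne (huniq j hj _ (hp i hi).1 h),
      fun i hi j hj hne h => ?_⟩
    have := hA (p i) (hJA (hp i hi).1) i (Finset.mem_sdiff.1 hi).1 j (Finset.mem_sdiff.1 hj).1
      (hp i hi).2 h fun h' => ?_
    · exact hinj i hi j hj hne (huniq j hj _ (hp i hi).1 this)
    · exact (Finset.mem_sdiff.1 hj).2 (h' ▸ (hp i hi).1)

theorem card_add_one_le {α : ℕ} (hα : ∀ I, Independent H I → I.card ≤ α) {I : Finset V} {u : V}
    (hI : Independent H I) (hu : ∀ x ∈ I, ¬ H.Adj u x ∧ x ≠ u) : I.card + 1 ≤ α := by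
  classical
  rw [← Finset.card_insert_of_notMem (a := u) fun h => (hu u h).2 rfl]
  apply hα
  intro a ha b hb hab
  rcases Finset.mem_insert.1 ha with rfl | ha' <;> rcases Finset.mem_insert.1 hb with rfl | hb'
  · exact hab.ne rfl
  · exact (hu b hb').1 hab
  · exact (hu a ha').1 hab.symm
  · exact hI a ha' b hb' hab

theorem IsInducedMatching.swap {A Y : Finset V} {p q : V → V} (h : IsInducedMatching H A Y p q) :
    IsInducedMatching H A Y q p :=
  ⟨h.right_mem, h.left_mem, fun i hi => (h.adj i hi).symm, h.right_right,
    fun i hi j hj hne hadj => h.left_right j hj i hi hne.symm hadj.symm, h.left_left⟩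

open Classical in
theorem IsInducedMatching.ite {A Y : Finset V} {p q : V → V} (h : IsInducedMatching H A Y p q)
    (c : V → Prop) : IsInducedMatching H A Y (fun i => if c i then p i else q i)
      (fun i => if c i then q i else p i) := by
  have hs := h.swap
  constructor
  · intro i hi; split_ifs
    exacts [h.left_mem i hi, h.right_mem i hi]
  · intro i hi; split_ifs
    exacts [h.right_mem i hi, h.left_mem i hi]
  · intro i hi; split_ifs
    exacts [h.adj i hi, hs.adj i hi]
  · intro i hi j hj hne; split_ifs
    exacts [h.left_left i hi j hj hne, h.left_right i hi j hj hne, hs.left_right i hi j hj hne,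
      hs.left_left i hi j hj hne]
  · intro i hi j hj hne; split_ifs
    exacts [h.left_right i hi j hj hne, h.left_left i hi j hj hne, hs.left_left i hi j hj hne,
      hs.left_right i hi j hj hne]
  · intro i hi j hj hne; split_ifs
    exacts [h.right_right i hi j hj hne, hs.left_right i hi j hj hne,
      h.left_right i hi j hj hne, h.left_left i hi j hj hne]

variable [Fintype V]

open Classical in
/-- The vertices adjacent to neither `u` nor `v`. -/
noncomputable def avoiding (H : SimpleGraph V) (u v : V) : Finset V :=
  {x | ¬ H.Adj u x ∧ ¬ H.Adj v x}

open Classical in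
/-- The vertices whose only neighbour among `u`, `v`, `w` is `u`. -/
noncomputable def privateNbrs (H : SimpleGraph V) (u v w : V) : Finset V :=
  {x | H.Adj u x ∧ ¬ H.Adj v x ∧ ¬ H.Adj w x}

open Classical in
/-- The vertices other than `w` whose neighbours among `u`, `v`, `w` are `u` and `v`. -/
noncomputable def sharedNbrs (H : SimpleGraph V) (u v w : V) : Finset V :=
  {x | H.Adj u x ∧ H.Adj v x ∧ ¬ H.Adj w x ∧ x ≠ w}

@[simp] theorem mem_avoiding {u v x : V} :
    x ∈ avoiding H u v ↔ ¬ H.Adj u x ∧ ¬ H.Adj v x := by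
  simp [avoiding]

@[simp] theorem mem_privateNbrs {u v w x : V} :
    x ∈ privateNbrs H u v w ↔ H.Adj u x ∧ ¬ H.Adj v x ∧ ¬ H.Adj w x := by
  simp [privateNbrs]

@[simp] theorem mem_sharedNbrs {u v w x : V} :
    x ∈ sharedNbrs H u v w ↔ H.Adj u x ∧ H.Adj v x ∧ ¬ H.Adj w x ∧ x ≠ w := by
  simp [sharedNbrs]

theorem sharedNbrs_comm (u v w : V) : sharedNbrs H u v w = sharedNbrs H v u w := by
  ext x
  simp only [mem_sharedNbrs]
  tauto

theorem privateNbrs_comm (u v w : V) : privateNbrs H u v w = privateNbrs H u w v := by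
  ext x
  simp only [mem_privateNbrs]
  tauto

theorem privateNbrs_subset_avoiding (u v w : V) : privateNbrs H u v w ⊆ avoiding H v w := by
  intro x hx
  simp only [mem_privateNbrs, mem_avoiding] at hx ⊢
  exact hx.2

theorem NoP3P2.inducesNoP3_avoiding (hP : NoP3P2 H) {u v : V} (huv : H.Adj u v) :
    InducesNoP3 H (avoiding H u v) := by
  intro x hx y hy z hz hxy hyz hxz
  by_contra hn
  simp only [mem_avoiding, H.adj_comm u, H.adj_comm v] at hx hy hz
  exact hP x y z u v hxy hyz hxz hn huv hx.1 hx.2 hy.1 hy.2 hz.1 hz.2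

theorem NoP3P2.cliqueCover_avoiding (hP : NoP3P2 H) {α : ℕ}
    (hα : ∀ I, Independent H I → I.card ≤ α) {u v : V} (huv : H.Adj u v) :
    CliqueCover H (avoiding H u v) (α - 1) := by
  classical
  obtain ⟨I, hI, hind, hcov⟩ := (hP.inducesNoP3_avoiding huv).exists_cliqueCover
  refine hcov.mono subset_rfl (Nat.le_sub_one_of_lt (card_add_one_le hα (u := u) hind ?_))
  intro x hx
  have := mem_avoiding.1 (hI hx)
  exact ⟨this.1, fun h => this.2 (h ▸ huv.symm)⟩

theorem NoK4.independent_sharedNbrs (hK : NoK4 H) {u v : V} (huv : H.Adj u v) (w : V) :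
    Independent H (sharedNbrs H u v w) := by
  intro x hx y hy hxy
  simp only [mem_sharedNbrs] at hx hy
  exact hK u v x y huv hx.1 hy.1 hx.2.1 hy.2.1 hxy

theorem NoK4.card_sharedNbrs (hK : NoK4 H) {α : ℕ} (hα : ∀ I, Independent H I → I.card ≤ α)
    {u v : V} (huv : H.Adj u v) (w : V) : (sharedNbrs H u v w).card + 1 ≤ α :=
  card_add_one_le hα (u := w) (hK.independent_sharedNbrs huv w) fun _ hx =>
    (mem_sharedNbrs.1 hx).2.2

/-- An edge in the private neighbourhood of `u` is dominated by exactly one of its ends from each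
vertex adjacent to `u` and to exactly one of `v` and `w`. -/
theorem adj_iff_not_adj_of_private_edge (hK : NoK4 H) (hP : NoP3P2 H) {u v w x y z : V}
    (hvw : H.Adj v w) (hx : x ∈ privateNbrs H u v w) (hy : y ∈ privateNbrs H u v w)
    (hxy : H.Adj x y) (hz : z ∈ sharedNbrs H u v w) : H.Adj z x ↔ ¬ H.Adj z y := by
  simp only [mem_privateNbrs, mem_sharedNbrs, H.adj_comm w z] at hx hy hz
  constructor
  · exact fun h1 h2 => hK u z x y hz.1 hx.1 hy.1 h1 h2 hxy
  · intro h2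
    by_contra h1
    exact hP z v w x y hz.2.1.symm hvw hz.2.2.2 hz.2.2.1 hxy h1 h2 hx.2.1 hy.2.1 hx.2.2 hy.2.2

/-- If the private neighbourhood of `u` contains a large induced matching, one side of which is
dominated by `z`, and `z` has a neighbour `z'` among the common neighbours of `u` and `w`, then
these common neighbours together with `v` and that side of the matching are independent. -/
theorem card_sharedNbrs_add_card_matching (hK : NoK4 H) (hP : NoP3P2 H) {α : ℕ}
    (hα : ∀ I, Independent H I → I.card ≤ α) {u v w z z' : V} (huw : H.Adj u w)
    (hvw : H.Adj v w) {Y : Finset V} {p q : V → V}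
    (hM : IsInducedMatching H (privateNbrs H u v w) Y p q) (hY : 4 ≤ Y.card)
    (hz : z ∈ sharedNbrs H u v w) (hz' : z' ∈ sharedNbrs H u w v) (hzz' : H.Adj z z')
    (hp : ∀ i ∈ Y, H.Adj z (p i)) : (sharedNbrs H u w v).card + Y.card + 1 ≤ α := by
  classical
  have hind := hK.independent_sharedNbrs huw v
  have one_side : ∀ y ∈ sharedNbrs H u w v, ∀ i ∈ Y, H.Adj y (p i) ↔ ¬ H.Adj y (q i) := by
    intro y hy i hi
    refine adj_iff_not_adj_of_private_edge hK hP hvw.symm ?_ ?_ (hM.adj i hi) hy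
    · rw [privateNbrs_comm]; exact hM.left_mem i hi
    · rw [privateNbrs_comm]; exact hM.right_mem i hi
  have one_side_z : ∀ i ∈ Y, ¬ H.Adj z (q i) := fun i hi =>
    (adj_iff_not_adj_of_private_edge hK hP hvw (hM.left_mem i hi) (hM.right_mem i hi)
      (hM.adj i hi) hz).1 (hp i hi)
  have hp_mem : ∀ i ∈ Y, H.Adj u (p i) ∧ ¬ H.Adj v (p i) ∧ ¬ H.Adj w (p i) :=
    fun i hi => mem_privateNbrs.1 (hM.left_mem i hi)
  have hq_mem : ∀ i ∈ Y, H.Adj u (q i) ∧ ¬ H.Adj v (q i) ∧ ¬ H.Adj w (q i) :=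
    fun i hi => mem_privateNbrs.1 (hM.right_mem i hi)
  have hz_mem := mem_sharedNbrs.1 hz
  have hz'_mem := mem_sharedNbrs.1 hz'
  have hinj : ∀ i ∈ Y, ∀ j ∈ Y, i ≠ j → p i ≠ p j := fun i hi j hj hne h =>
    hM.left_right i hi j hj hne (h ▸ hM.adj j hj)
  have hz'p : ∀ i ∈ Y, ¬ H.Adj z' (p i) := fun i hi h =>
    hK u z z' (p i) hz_mem.1 hz'_mem.1 (hp_mem i hi).1 hzz' (hp i hi) h
  have key : ∀ y ∈ sharedNbrs H u w v, ∀ i ∈ Y, ¬ H.Adj y (p i) := by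
    intro y hy i₀ hi₀ hadj
    have hy_mem := mem_sharedNbrs.1 hy
    have hyz : ¬ H.Adj z y := fun h =>
      hK u z y (p i₀) hz_mem.1 hy_mem.1 (hp_mem i₀ hi₀).1 h (hp i₀ hi₀) hadj
    have hsum := Finset.card_filter_add_card_filter_not (s := Y) (fun i => H.Adj y (p i))
    rcases (by omega : 2 < (Y.filter fun i => H.Adj y (p i)).card ∨
      1 < (Y.filter fun i => ¬ H.Adj y (p i)).card) with h | h
    · obtain ⟨i, j, l, hi, hj, hl, hij, hil, hjl⟩ := Finset.two_lt_card_iff.1 h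
      simp only [Finset.mem_filter] at hi hj hl
      refine hP (p i) y (p j) (q l) z' hi.2.symm hj.2 (hinj i hi.1 j hj.1 hij)
        (hM.left_left i hi.1 j hj.1 hij) ?_ (hM.left_right i hi.1 l hl.1 hil) ?_ ?_ ?_
        (hM.left_right j hj.1 l hl.1 hjl) ?_
      · by_contra hn
        exact hz'p l hl.1 ((one_side z' hz' l hl.1).2 fun h => hn h.symm)
      · exact fun h => hz'p i hi.1 h.symm
      · exact (one_side y hy l hl.1).1 hl.2
      · exact hind y hy z' hz'
      · exact fun h => hz'p j hj.1 h.symm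
    · obtain ⟨i, j, hi, hj, hij⟩ := Finset.one_lt_card_iff.1 h
      simp only [Finset.mem_filter] at hi hj
      refine hP v z (p i) (q j) y hz_mem.2.1 (hp i hi.1) ?_ (hp_mem i hi.1).2.1 ?_
        (hq_mem j hj.1).2.1 hy_mem.2.2.1 (one_side_z j hj.1) hyz
        (hM.left_right i hi.1 j hj.1 hij) fun h => hi.2 h.symm
      · exact fun h => (hp_mem i hi.1).2.2 (h ▸ hvw.symm)
      · by_contra hn
        exact hj.2 ((one_side y hy j hj.1).2 fun h => hn h.symm)
  have hcard : (sharedNbrs H u w v ∪ Y.image p).card = (sharedNbrs H u w v).card + Y.card := by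
    rw [Finset.card_union_of_disjoint, Finset.card_image_of_injOn]
    · intro i hi j hj h
      by_contra hne
      exact hinj i hi j hj hne h
    · rw [Finset.disjoint_left]
      intro a ha hb
      obtain ⟨i, hi, rfl⟩ := Finset.mem_image.1 hb
      exact (hp_mem i hi).2.2 (mem_sharedNbrs.1 ha).2.1
  rw [← hcard]
  refine card_add_one_le hα (u := v) ?_ ?_
  · intro a ha b hb hab
    rcases Finset.mem_union.1 ha with ha | ha <;> rcases Finset.mem_union.1 hb with hb | hb
    · exact hind a ha b hb hab
    · obtain ⟨i, hi, rfl⟩ := Finset.mem_image.1 hb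
      exact key a ha i hi hab
    · obtain ⟨i, hi, rfl⟩ := Finset.mem_image.1 ha
      exact key b hb i hi hab.symm
    · obtain ⟨i, hi, rfl⟩ := Finset.mem_image.1 ha
      obtain ⟨j, hj, rfl⟩ := Finset.mem_image.1 hb
      rcases eq_or_ne i j with rfl | hne
      · exact hab.ne rfl
      · exact hM.left_left i hi j hj hne hab
  · intro x hx
    rcases Finset.mem_union.1 hx with hx | hx
    · exact (mem_sharedNbrs.1 hx).2.2
    · obtain ⟨i, hi, rfl⟩ := Finset.mem_image.1 hx
      exact ⟨(hp_mem i hi).2.1, fun h => (hp_mem i hi).2.2 (h ▸ hvw.symm)⟩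

theorem cliqueCover_univ_of_triangle_of_matching (hK : NoK4 H) (hP : NoP3P2 H) {α : ℕ}
    (hα : ∀ I, Independent H I → I.card ≤ α) {u v w : V} (huv : H.Adj u v) (huw : H.Adj u w)
    (hvw : H.Adj v w) {Y : Finset V} {p q : V → V}
    (hM : IsInducedMatching H (privateNbrs H u v w) Y p q)
    (hu : (privateNbrs H u v w).card + 1 ≤ α + Y.card)
    (hv : (privateNbrs H v u w).card + 1 ≤ α + Y.card) :
    CliqueCover H Finset.univ (4 * α) := by
  classical
  have hT : CliqueCover H {u, v, w} 1 := by
    refine cliqueCover_one ?_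
    intro a ha b hb hne
    have := @SimpleGraph.Adj.symm V H
    grind
  have hA := hP.cliqueCover_avoiding hα huv
  have hcover : (Finset.univ : Finset V) ⊆ {u, v, w} ∪ (avoiding H u v ∪
      (privateNbrs H u v w ∪ (privateNbrs H v u w ∪
        (sharedNbrs H v w u ∪ (sharedNbrs H u w v ∪ sharedNbrs H u v w))))) := by
    intro x _
    have hKx := hK u v w x huv huw
    simp only [Finset.mem_union, Finset.mem_insert, Finset.mem_singleton, mem_avoiding,
      mem_privateNbrs, mem_sharedNbrs]
    tauto
  have h1 := hK.card_sharedNbrs hα hvw u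
  have h2 := hK.card_sharedNbrs hα huw v
  have h3 := hK.card_sharedNbrs hα huv w
  by_cases hedge : Independent H (sharedNbrs H u w v ∪ sharedNbrs H u v w)
  · have hPu := (hP.cliqueCover_avoiding hα hvw).mono (privateNbrs_subset_avoiding u v w) le_rfl
    have hPv := (hP.cliqueCover_avoiding hα huw).mono (privateNbrs_subset_avoiding v u w) le_rfl
    have hS := cliqueCover_of_bipartite hα (hK.independent_sharedNbrs hvw u) hedge
    exact (hT.union (hA.union (hPu.union (hPv.union hS)))).mono hcover (by omega)
  · have hcard : (sharedNbrs H u w v).card + (sharedNbrs H u v w).card + 2 * Y.card ≤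
        2 * α + 4 := by
      by_cases hY : 4 ≤ Y.card
      · obtain ⟨z, hz, z', hz', hzz'⟩ : ∃ z ∈ sharedNbrs H u v w, ∃ z' ∈ sharedNbrs H u w v,
            H.Adj z z' := by
          simp only [Independent, not_forall, not_not] at hedge
          obtain ⟨a, ha, b, hb, hab⟩ := hedge
          rcases Finset.mem_union.1 ha with ha | ha <;> rcases Finset.mem_union.1 hb with hb | hb
          · exact absurd hab (hK.independent_sharedNbrs huw v a ha b hb)
          · exact ⟨b, hb, a, ha, hab.symm⟩
          · exact ⟨a, ha, b, hb, hab⟩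
          · exact absurd hab (hK.independent_sharedNbrs huv w a ha b hb)
        have hM' := hM.ite fun i => H.Adj z (p i)
        have hleft : ∀ i ∈ Y, H.Adj z (if H.Adj z (p i) then p i else q i) := by
          intro i hi
          split_ifs with h
          · exact h
          · by_contra hn
            exact h ((adj_iff_not_adj_of_private_edge hK hP hvw (hM.left_mem i hi)
              (hM.right_mem i hi) (hM.adj i hi) hz).2 hn)
        have e1 := card_sharedNbrs_add_card_matching hK hP hα huw hvw hM' hY hz hz' hzz' hleft
        have hM'' := hM'.swap
        rw [privateNbrs_comm] at hM''
        have e2 := card_sharedNbrs_add_card_matching hK hP hα huv hvw.symm hM'' hY hz' hz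
          hzz'.symm fun i hi => ?_
        · omega
        · refine (adj_iff_not_adj_of_private_edge hK hP hvw.symm (hM''.left_mem i hi)
            (hM''.right_mem i hi) (hM''.adj i hi) hz').2 fun h => ?_
          exact hK u z z' _ (mem_sharedNbrs.1 hz).1 (mem_sharedNbrs.1 hz').1
            (mem_privateNbrs.1 (hM''.right_mem i hi)).1 hzz' (hleft i hi) h
      · omega
    have hR := cliqueCover_half hα (privateNbrs H u v w ∪ (privateNbrs H v u w ∪
      (sharedNbrs H v w u ∪ (sharedNbrs H u w v ∪ sharedNbrs H u v w))))
    have c1 := Finset.card_union_le (privateNbrs H u v w) (privateNbrs H v u w ∪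
      (sharedNbrs H v w u ∪ (sharedNbrs H u w v ∪ sharedNbrs H u v w)))
    have c2 := Finset.card_union_le (privateNbrs H v u w)
      (sharedNbrs H v w u ∪ (sharedNbrs H u w v ∪ sharedNbrs H u v w))
    have c3 := Finset.card_union_le (sharedNbrs H v w u) (sharedNbrs H u w v ∪ sharedNbrs H u v w)
    have c4 := Finset.card_union_le (sharedNbrs H u w v) (sharedNbrs H u v w)
    exact (hT.union (hA.union hR)).mono hcover (by omega)

theorem exists_isInducedMatching_privateNbrs (hK : NoK4 H) (hP : NoP3P2 H) {α : ℕ}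
    (hα : ∀ I, Independent H I → I.card ≤ α) {v w : V} (u : V) (hvw : H.Adj v w) :
    ∃ (Y : Finset V) (p q : V → V), IsInducedMatching H (privateNbrs H u v w) Y p q ∧
      (privateNbrs H u v w).card + 1 ≤ α + Y.card := by
  classical
  have hsub := privateNbrs_subset_avoiding (H := H) u v w
  have hnoP3 : InducesNoP3 H (privateNbrs H u v w) := fun x hx y hy z hz =>
    hP.inducesNoP3_avoiding hvw x (hsub hx) y (hsub hy) z (hsub hz)
  obtain ⟨J, Y, p, q, hJ, hind, hcard, hM⟩ := hnoP3.exists_isInducedMatching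
    fun x hx y hy z hz hxy hxz hyz => hK u x y z (mem_privateNbrs.1 hx).1 (mem_privateNbrs.1 hy).1
      (mem_privateNbrs.1 hz).1 hxy hxz hyz
  have := card_add_one_le hα (u := v) hind fun x hx =>
    ⟨(mem_privateNbrs.1 (hJ hx)).2.1, fun h => (mem_privateNbrs.1 (hJ hx)).2.2 (h ▸ hvw.symm)⟩
  exact ⟨Y, p, q, hM, by omega⟩

theorem cliqueCover_univ_of_triangle (hK : NoK4 H) (hP : NoP3P2 H) {α : ℕ}
    (hα : ∀ I, Independent H I → I.card ≤ α) {u v w : V} (huv : H.Adj u v) (huw : H.Adj u w)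
    (hvw : H.Adj v w) : CliqueCover H Finset.univ (4 * α) := by
  obtain ⟨Y, p, q, hM, hu⟩ := exists_isInducedMatching_privateNbrs hK hP hα u hvw
  obtain ⟨Y', p', q', hM', hv⟩ := exists_isInducedMatching_privateNbrs hK hP hα v huw
  rcases le_total Y'.card Y.card with h | h
  · exact cliqueCover_univ_of_triangle_of_matching hK hP hα huv huw hvw hM hu (by omega)
  · exact cliqueCover_univ_of_triangle_of_matching hK hP hα huv.symm hvw huw hM' hv (by omega)

theorem cliqueCover_univ (hK : NoK4 H) (hP : NoP3P2 H) {α : ℕ}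
    (hα : ∀ I, Independent H I → I.card ≤ α) : CliqueCover H Finset.univ (4 * α) := by
  classical
  by_cases htri : ∃ u v w, H.Adj u v ∧ H.Adj u w ∧ H.Adj v w
  · obtain ⟨u, v, w, huv, huw, hvw⟩ := htri
    exact cliqueCover_univ_of_triangle hK hP hα huv huw hvw
  simp only [not_exists, not_and] at htri
  have hnbr : ∀ u, Independent H (Finset.univ.filter (H.Adj u)) := by
    intro u x hx y hy hxy
    exact htri u x y (Finset.mem_filter.1 hx).2 (Finset.mem_filter.1 hy).2 hxy
  by_cases hedge : ∃ u v, H.Adj u v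
  · obtain ⟨u, v, huv⟩ := hedge
    refine ((hP.cliqueCover_avoiding hα huv).union
      (cliqueCover_of_bipartite hα (hnbr u) (hnbr v))).mono ?_ (by omega)
    intro x _
    simp only [Finset.mem_union, mem_avoiding, Finset.mem_filter, Finset.mem_univ, true_and]
    tauto
  · simp only [not_exists] at hedge
    have hind : Independent H Finset.univ := fun x _ y _ => hedge x y
    exact (cliqueCover_of_bipartite hα hind hind).mono (by simp) (by omega)

end CliqueCover

theorem contains_of_injective {V W : Type*} {G : SimpleGraph V} {H : SimpleGraph W} (f : W → V)
    (hf : ∀ i j, f i = f j → i = j) (h : ∀ i j, G.Adj (f i) (f j) ↔ H.Adj i j) : Contains G H :=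
  ⟨⟨⟨f, fun i j => hf i j⟩, h _ _⟩⟩

theorem noK4_compl {V : Type*} {G : SimpleGraph V} (h : ¬ Contains G (⊥ : SimpleGraph (Fin 4))) :
    NoK4 Gᶜ := by
  intro a b c d hab hac had hbc hbd hcd
  simp only [compl_adj] at hab hac had hbc hbd hcd
  have := @SimpleGraph.Adj.symm V G
  refine h (contains_of_injective ![a, b, c, d] ?_ ?_)
  · intro i j
    fin_cases i <;> fin_cases j <;> simp <;> grind
  · intro i j
    fin_cases i <;> fin_cases j <;> simp <;> grind

theorem noP3P2_compl {V : Type*} {G : SimpleGraph V} (h : ¬ Contains G P3P2ᶜ) :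
    NoP3P2 Gᶜ := by
  intro a b c d e hab hbc hne hac hde had hae hbd hbe hcd hce
  have := @SimpleGraph.Adj.symm V G
  simp only [compl_adj] at *
  refine h (contains_of_injective ![a, b, c, d, e] ?_ ?_)
  · intro i j
    fin_cases i <;> fin_cases j <;> simp <;> grind
  · intro i j
    fin_cases i <;> fin_cases j <;> simp [P3P2] <;> grind

theorem chromatic_le_four_mul_cliqueNum {V : Type*} [Fintype V] (G : SimpleGraph V)
    (h1 : ¬ Contains G (⊥ : SimpleGraph (Fin 4))) (h2 : ¬ Contains G P3P2ᶜ) :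
    G.chromaticNumber ≤ (4 * G.cliqueNum : ℕ) := by
  have hα : ∀ I, Independent Gᶜ I → I.card ≤ G.cliqueNum := by
    intro I hI
    refine IsClique.card_le_cliqueNum (G := G) (t := I) (tc := fun a ha b hb hab => ?_)
    by_contra hn
    exact hI a ha b hb ((compl_adj _ _ _).2 ⟨hab, hn⟩)
  obtain ⟨f, hf, hadj⟩ := cliqueCover_univ (noK4_compl h1) (noP3P2_compl h2) hα
  refine Colorable.chromaticNumber_le ⟨Coloring.mk (fun x => ⟨f x, hf x (Finset.mem_univ x)⟩) ?_⟩
  intro x y hxy h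
  exact ((compl_adj _ _ _).1 (hadj x (Finset.mem_univ x) y (Finset.mem_univ y)
    (congrArg Fin.val h) hxy.ne)).2 hxy
end

section
/- Let G be a (P₃∪P₂, K₄)-free graph. If G contains co-domino, then χ(G) ≤ 7. -/
open SimpleGraph

namespace TraceCert

/-- `f n`, with `n` evaluated first. -/
def eager {α : Type*} (n : ℕ) (f : ℕ → α) : α :=
  match n with
  | 0 => f 0
  | k + 1 => f (k + 1)

/-- `f l`, with the entries of `l` evaluated first. -/
def eagerList {α : Type*} : List ℕ → (List ℕ → α) → α
  | [], f => f []
  | n :: l, f => eager n fun m => eagerList l fun k => f (m :: k)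

/-- Adjacency of `i` and `j` in the graph on `ℕ` in which the neighbours of `i` are the bits of
`a[i]`. -/
def bitAdj (a : List ℕ) (i j : ℕ) : Bool := (a.getD i 0).testBit j

/-- Add a vertex whose neighbours are the bits of `t` to the graph coded by `a`. -/
def addRow (a : List ℕ) (t : ℕ) : List ℕ :=
  a.zipIdx.map (fun p => if t.testBit p.2 then p.1 + 2 ^ a.length else p.1) ++ [t]

/-- The bits of `M` that are not bits of `r`. -/
def without (M r : ℕ) : ℕ := M ^^^ (M &&& r)

/-- Two bits of `M` are adjacent. -/
def hasEdge (a : List ℕ) (M : ℕ) : Bool :=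
  a.zipIdx.any fun p => M.testBit p.2 && M &&& p.1 != 0

/-- A new vertex `v` whose neighbours in the graph coded by `a` are the bits of `t` completes a `K₄`
or an induced `P₃ ∪ P₂` in which the bit `i` of `t` is a neighbour of `v`. -/
def clashes (a : List ℕ) (t i : ℕ) : Bool :=
  eager t fun t => eager (a.getD i 0) fun r => eager (t &&& r) (hasEdge a) ||
    eager (without (without (2 ^ a.length - 1) t) r) fun R =>
      eager (without (t ^^^ r) (2 ^ i)) fun Y =>
        a.zipIdx.any fun q => R.testBit q.2 && eager (R &&& q.1) fun M => M != 0 &&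
          a.zipIdx.any fun r => M.testBit r.2 && (without (without Y q.1) r.1 != 0 ||
            without (without (R &&& r.1) q.1) (2 ^ q.2) != 0)

/-- A new vertex whose neighbours in the graph coded by `a` are the bits of `t` completes a `K₄` or
an induced `P₃ ∪ P₂`. -/
def completes (a : List ℕ) (t : ℕ) : Bool :=
  (List.range a.length).any fun i => t.testBit i && clashes a t i

/-- The one-bit extensions of the traces in `T` that are admissible over `a`. -/
def extend (a T : List ℕ) : List ℕ :=
  T.flatMap fun t => (if completes a t then [] else [t]) ++
    if clashes a (t + 2 ^ (a.length - 1)) (a.length - 1) then [] else [t + 2 ^ (a.length - 1)]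

/-- New vertices with traces `t` and `s` over `a` may be adjacent, where `no` lists pairs of traces
(given by their lowest `m` bits) already known to be nonadjacent. -/
def mayAdj (a : List ℕ) (no : List (ℕ × ℕ × ℕ)) (t s : ℕ) : Bool :=
  (no.all fun r => !(t % 2 ^ r.1 == r.2.1 && s % 2 ^ r.1 == r.2.2)
    && !(s % 2 ^ r.1 == r.2.1 && t % 2 ^ r.1 == r.2.2)) &&
  eagerList (addRow a t) fun b => !clashes b (s + 2 ^ a.length) a.length

/-- The vertices with trace `t` induce a graph of maximum degree at most one. -/
def isMatching (a : List ℕ) (t : ℕ) : Bool :=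
  t != 0 && hasEdge a (without (2 ^ a.length - 1) t)

/-- The base-7 digit of `ds` at position `k`. -/
def digit (ds k : ℕ) : ℕ := ds / 7 ^ k % 7

/-- Each trace of `T` with its colour, and a second colour for the classes inducing a matching. -/
def palette (n ds : ℕ) (ex : List (ℕ × ℕ)) (T : List ℕ) : List (ℕ × ℕ × ℕ) :=
  (T.zipIdx n).map fun p => (p.1, digit ds p.2, ((ex.lookup p.1).getD (digit ds p.2)) % 7)

/-- The colouring given by `ds` and `ex` is proper. -/
def isProper (ds : ℕ) (ex : List (ℕ × ℕ)) (a T : List ℕ) (no : List (ℕ × ℕ × ℕ)) : Bool :=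
  let S := palette a.length ds ex T
  ((List.range a.length).all fun i => (List.range a.length).all fun j =>
    !bitAdj a i j || digit ds i != digit ds j) &&
  ((List.range a.length).all fun i => S.all fun u =>
    !u.1.testBit i || (digit ds i != u.2.1 && digit ds i != u.2.2)) &&
  (S.all fun u => (u.2.1 != u.2.2 && isMatching a u.1) || !mayAdj a no u.1 u.1) &&
  (S.all fun u => S.all fun v => decide (v.1 ≤ u.1) ||
    (u.2.1 != v.2.1 && u.2.1 != v.2.2 && u.2.2 != v.2.1 && u.2.2 != v.2.2) ||
    !mayAdj a no u.1 v.1)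

/-- A case distinction on the existence of vertices with given traces, and of adjacent pairs of such
vertices, with a colouring in each case. -/
inductive Cert
  | leaf (ds : ℕ) (ex : List (ℕ × ℕ))
  | vert (p : ℕ) (yes no : Cert)
  | pair (p q : ℕ) (yes no : Cert)

/-- Verify a case distinction, for the base graph `a`, possible traces `T` and nonadjacent pairs of
traces `no`. -/
def Cert.check : Cert → List ℕ → List ℕ → List (ℕ × ℕ × ℕ) → Bool
  | .leaf ds ex, a, T, no => isProper ds ex a T no
  | .vert p y n, a, T, no =>
    (eagerList (addRow a p) fun b => eagerList (extend b T) fun U => y.check b U no) &&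
    eagerList (T.filter fun t => t != p) fun U => n.check a U no
  | .pair p q y n, a, T, no =>
    (eagerList (addRow a p) fun b => eagerList (extend b T) fun U =>
      eagerList (addRow b (q + 2 ^ a.length)) fun c => eagerList (extend c U) fun W =>
        y.check c W no) &&
    n.check a T ((a.length, p, q) :: no)

/-- The co-domino, coded by its rows of neighbours. -/
def baseRows : List ℕ := [50, 13, 10, 22, 41, 17]

/-- A case distinction proving that a graph containing the co-domino is 7-colourable. -/
def coDominoCert : Cert :=
  (.vert 28
    (.leaf 1223445343109145342432490 [(18, 3)])
  (.vert 56
    (.leaf 894034349120516817255 [(9, 3)])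
  (.pair 18 18
    (.pair 201 73
      (.leaf 5261546317576503788866866458901272507323429 [])
    (.pair 201 137
      (.leaf 9939183079873950733426060944441051873999264 [])
    (.pair 73 137
      (.pair 274 405
        (.leaf 7034387951523810448059845007497640409713649534991955633 [])
      (.pair 137 405
        (.leaf 6910273062696017921028438534793426740790672579627900265 [])
      (.pair 530 597
        (.leaf 8137932360010668835302011417907874857511666878650766625 [])
      (.pair 73 597
        (.leaf 7783394521597614686360505485178982518345846671640973160 [])
      (.vert 407
        (.leaf 21637951581017342149657185499141419248314717520 [])
      (.vert 599
        (.leaf 3363730878513981289471654292533921955315360797 [])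
      (.leaf 1229215421294907874472752061901128863745091180643 [])))))))
    (.leaf 42710607643825960530869996163086976 [(18, 2)]))))
  (.pair 9 9
    (.leaf 36214663519375039728687903215470054 [(9, 0)])
  (.leaf 32859603206017369065726 [])))))

theorem coDominoCert_check :
    coDominoCert.check baseRows
      ((List.range 64).filter fun t => !completes baseRows t) [] = true := by
  decide +kernel

variable {V : Type*} {G : SimpleGraph V} {f g : ℕ → V} {a T : List ℕ} {no : List (ℕ × ℕ × ℕ)}
  {x y : V}

theorem not_adj_of_k4_free (hK : ¬ Contains G (completeGraph (Fin 4))) {a b c d : V}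
    (hab : G.Adj a b) (hac : G.Adj a c) (had : G.Adj a d) (hbc : G.Adj b c) (hbd : G.Adj b d) :
    ¬ G.Adj c d := by
  intro hcd
  have key : ∀ i j : Fin 4, i ≠ j → G.Adj (![a, b, c, d] i) (![a, b, c, d] j) := by
    intro i j hij
    fin_cases i <;> fin_cases j <;>
      first
        | exact absurd rfl hij
        | simp [hab, hac, had, hbc, hbd, hcd, G.adj_comm]
  refine hK ⟨⟨⟨![a, b, c, d], fun i j hij => ?_⟩, fun {i j} => ?_⟩⟩
  · by_contra hne
    exact (key i j hne).ne hij
  · exact ⟨fun h => fun hij => h.ne (congrArg _ hij), fun h => key i j h⟩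

theorem not_adj_of_p3p2_free (hP : ¬ Contains G P3P2) {a b c d e : V}
    (hab : G.Adj a b) (hbc : G.Adj b c) (hne : a ≠ c) (hac : ¬ G.Adj a c)
    (had : ¬ G.Adj a d) (hae : ¬ G.Adj a e) (hbd : ¬ G.Adj b d) (hbe : ¬ G.Adj b e)
    (hcd : ¬ G.Adj c d) (hce : ¬ G.Adj c e) : ¬ G.Adj d e := by
  intro hde
  have key : ∀ i j : Fin 5, G.Adj (![a, b, c, d, e] i) (![a, b, c, d, e] j) ↔ P3P2.Adj i j := by
    intro i j
    fin_cases i <;> fin_cases j <;>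
      simp [P3P2, hab, hbc, hde, hab.symm, hbc.symm, hde.symm, hac, had, hae, hbd, hbe, hcd, hce,
        mt G.adj_symm hac, mt G.adj_symm had, mt G.adj_symm hae, mt G.adj_symm hbd,
        mt G.adj_symm hbe, mt G.adj_symm hcd, mt G.adj_symm hce]
  refine hP ⟨⟨⟨![a, b, c, d, e], fun i j hij => ?_⟩, fun {i j} => key i j⟩⟩
  have hda : a ≠ d := by rintro rfl; exact hbd hab.symm
  have hea : a ≠ e := by rintro rfl; exact hbe hab.symm
  have hdb : b ≠ d := by rintro rfl; exact had hab
  have heb : b ≠ e := by rintro rfl; exact hae hab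
  have hdc : c ≠ d := by rintro rfl; exact hbd hbc
  have hec : c ≠ e := by rintro rfl; exact hbe hbc
  have h1 := hab.ne
  have h2 := hbc.ne
  have h3 := hde.ne
  fin_cases i <;> fin_cases j <;> simp_all

open Classical in
/-- The set of `i < n` with `f i` adjacent to `x`, as a binary number. -/
noncomputable def trace (G : SimpleGraph V) (f : ℕ → V) : ℕ → V → ℕ
  | 0, _ => 0
  | n + 1, x => trace G f n x + if G.Adj x (f n) then 2 ^ n else 0

theorem trace_lt (n : ℕ) (x : V) : trace G f n x < 2 ^ n := by
  induction n with
  | zero => simp [trace]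
  | succ n ih =>
    rw [trace, pow_succ]
    split_ifs <;> omega

theorem testBit_trace {n i : ℕ} (hi : i < n) :
    (trace G f n x).testBit i = true ↔ G.Adj x (f i) := by
  induction n with
  | zero => omega
  | succ n ih =>
    rw [trace, add_comm]
    rcases Nat.lt_succ_iff_lt_or_eq.1 hi with h | rfl
    · rw [← ih h]
      split_ifs
      · rw [Nat.testBit_two_pow_add_gt h]
      · rw [zero_add]
    · have := Nat.testBit_lt_two_pow (trace_lt (G := G) (f := f) i x)
      split_ifs with h
      · simp [Nat.testBit_two_pow_add_eq, this, h]
      · simp [this, h]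

theorem trace_mod {m n : ℕ} (h : m ≤ n) : trace G f n x % 2 ^ m = trace G f m x := by
  induction n, h using Nat.le_induction with
  | base => exact Nat.mod_eq_of_lt (trace_lt m x)
  | succ n hmn ih =>
    rw [trace]
    split_ifs
    · obtain ⟨k, hk⟩ := pow_dvd_pow 2 hmn
      rw [hk, Nat.add_mul_mod_self_left, ih]
    · exact ih

theorem trace_congr {n : ℕ} (h : ∀ i < n, f i = g i) : trace G f n x = trace G g n x := by
  induction n with
  | zero => rfl
  | succ n ih => rw [trace, trace, ih fun i hi => h i (by omega), h n (by omega)]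

theorem trace_update {m n : ℕ} (h : m ≤ n) :
    trace G (Function.update f n x) m y = trace G f m y :=
  trace_congr fun _ hi => Function.update_of_ne (by omega) _ _

theorem eager_eq {α : Type*} (n : ℕ) (h : ℕ → α) : eager n h = h n := by
  cases n <;> rfl

theorem eagerList_eq {α : Type*} (l : List ℕ) (h : List ℕ → α) : eagerList l h = h l := by
  induction l generalizing h with
  | nil => rfl
  | cons n l ih => rw [eagerList, eager_eq, ih]

theorem testBit_without (M r i : ℕ) :
    (without M r).testBit i = true ↔ M.testBit i = true ∧ ¬ r.testBit i = true := by
  rw [without, Nat.testBit_xor, Nat.testBit_and]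
  cases M.testBit i <;> cases r.testBit i <;> simp

theorem bne_zero_iff {M : ℕ} : (M != 0) = true ↔ ∃ i, M.testBit i = true := by
  rw [bne_iff_ne]
  refine ⟨Nat.exists_testBit_of_ne_zero, ?_⟩
  rintro ⟨i, hi⟩ rfl
  simp at hi

theorem lt_of_testBit {M n i : ℕ} (hM : M < 2 ^ n) (hi : M.testBit i = true) : i < n := by
  by_contra h
  rw [Nat.testBit_lt_two_pow (hM.trans_le (Nat.pow_le_pow_right two_pos (not_lt.1 h)))] at hi
  exact Bool.false_ne_true hi

theorem any_zipIdx {p : ℕ × ℕ → Bool} :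
    a.zipIdx.any p = true ↔ ∃ i < a.length, p (a.getD i 0, i) = true := by
  rw [List.any_eq_true]
  constructor
  · rintro ⟨⟨r, i⟩, hr, h⟩
    rw [List.mk_mem_zipIdx_iff_getElem?] at hr
    obtain ⟨hi, rfl⟩ := List.getElem?_eq_some_iff.1 hr
    exact ⟨i, hi, by simpa [hi] using h⟩
  · rintro ⟨i, hi, h⟩
    exact ⟨_, by rw [List.mk_mem_zipIdx_iff_getElem?]; simp [hi], h⟩

theorem length_addRow (a : List ℕ) (t : ℕ) : (addRow a t).length = a.length + 1 := by
  simp [addRow]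

theorem getD_addRow_of_lt {t i : ℕ} (hi : i < a.length) : (addRow a t).getD i 0 =
    if t.testBit i then a.getD i 0 + 2 ^ a.length else a.getD i 0 := by
  simp [addRow, List.getElem?_append_left, hi]

theorem getD_addRow_length {t : ℕ} : (addRow a t).getD a.length 0 = t := by
  simp [addRow]

/-- `f` embeds the graph coded by `a` as an induced subgraph of `G`. -/
structure IsBase (G : SimpleGraph V) (f : ℕ → V) (a : List ℕ) : Prop where
  inj : ∀ i < a.length, ∀ j < a.length, f i = f j → i = j
  lt : ∀ i < a.length, a.getD i 0 < 2 ^ a.length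
  adj : ∀ i < a.length, ∀ j < a.length, ((a.getD i 0).testBit j = true ↔ G.Adj (f i) (f j))

/-- `x` is not among the first `n` values of `f`. -/
def IsNew (f : ℕ → V) (n : ℕ) (x : V) : Prop := ∀ i < n, f i ≠ x

theorem isNew_update {n : ℕ} :
    IsNew (Function.update f n x) (n + 1) y ↔ IsNew f n y ∧ x ≠ y := by
  refine ⟨fun h => ⟨fun i hi => ?_, by simpa using h n (by omega)⟩, fun h i hi => ?_⟩
  · simpa [Function.update_of_ne (show i ≠ n by omega)] using h i (by omega)
  · rcases Nat.lt_succ_iff_lt_or_eq.1 hi with hi | rfl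
    · rw [Function.update_of_ne (by omega)]
      exact h.1 i hi
    · simpa using h.2

theorem trace_update_succ_of_adj {n : ℕ} (h : G.Adj x y) :
    trace G (Function.update f n x) (n + 1) y = trace G f n y + 2 ^ n := by
  rw [trace, trace_update le_rfl]
  simp [h.symm]

theorem IsBase.snoc (hB : IsBase G f a) (hx : IsNew f a.length x) :
    IsBase G (Function.update f a.length x) (addRow a (trace G f a.length x)) := by
  have hf : ∀ i < a.length, Function.update f a.length x i = f i :=
    fun i hi => Function.update_of_ne (by omega) _ _
  have hT := trace_lt (G := G) (f := f) a.length x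
  refine ⟨fun i hi j hj h => ?_, fun i hi => ?_, fun i hi j hj => ?_⟩ <;>
    rw [length_addRow] at * <;>
    rcases Nat.lt_succ_iff_lt_or_eq.1 hi with hi | rfl
  · rcases Nat.lt_succ_iff_lt_or_eq.1 hj with hj | rfl
    · rw [hf i hi, hf j hj] at h
      exact hB.inj i hi j hj h
    · rw [hf i hi, Function.update_self] at h
      exact absurd h (hx i hi)
  · rcases Nat.lt_succ_iff_lt_or_eq.1 hj with hj | rfl
    · rw [hf j hj, Function.update_self] at h
      exact absurd h.symm (hx j hj)
    · rfl
  · have := hB.lt i hi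
    rw [getD_addRow_of_lt hi, pow_succ]
    split_ifs <;> omega
  · rw [getD_addRow_length, pow_succ]
    omega
  · have hr := hB.lt i hi
    rw [getD_addRow_of_lt hi, hf i hi]
    rcases Nat.lt_succ_iff_lt_or_eq.1 hj with hj | rfl
    · rw [hf j hj, ← hB.adj i hi j hj, add_comm]
      split_ifs
      · rw [Nat.testBit_two_pow_add_gt hj]
      · rfl
    · rw [Function.update_self, G.adj_comm, ← testBit_trace (n := a.length) hi, add_comm]
      split_ifs with h
      · rw [Nat.testBit_two_pow_add_eq, Nat.testBit_lt_two_pow hr, h]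
        rfl
      · simp only [Nat.testBit_lt_two_pow hr, h]
  · rw [getD_addRow_length, Function.update_self]
    rcases Nat.lt_succ_iff_lt_or_eq.1 hj with hj | rfl
    · rw [hf j hj, testBit_trace hj]
    · simp [Nat.testBit_lt_two_pow hT]

theorem IsBase.exists_of_hasEdge {M : ℕ} (hB : IsBase G f a) (h : hasEdge a M = true) :
    ∃ c < a.length, ∃ d < a.length, M.testBit c = true ∧ M.testBit d = true ∧
      G.Adj (f c) (f d) := by
  obtain ⟨c, hc, h⟩ := any_zipIdx.1 h
  rw [Bool.and_eq_true, bne_zero_iff] at h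
  obtain ⟨hMc, d, hd⟩ := h
  rw [Nat.testBit_and, Bool.and_eq_true] at hd
  have hdl := lt_of_testBit (hB.lt c hc) hd.2
  exact ⟨c, hc, d, hdl, hMc, hd.1, (hB.adj c hc d hdl).1 hd.2⟩

theorem testBit_complement_trace {n i : ℕ} :
    (without (2 ^ n - 1) (trace G f n x)).testBit i = true ↔ i < n ∧ ¬ G.Adj x (f i) := by
  rw [testBit_without, Nat.testBit_two_pow_sub_one, decide_eq_true_eq]
  exact and_congr_right fun hi => not_congr (testBit_trace hi)

theorem IsBase.not_clashes (hP : ¬ Contains G P3P2) (hK : ¬ Contains G (completeGraph (Fin 4)))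
    (hB : IsBase G f a) (hx : IsNew f a.length x) {i : ℕ} (hi : i < a.length)
    (hxi : G.Adj x (f i)) : clashes a (trace G f a.length x) i = false := by
  rw [← Bool.not_eq_true]
  intro h
  simp only [clashes, eager_eq, Bool.or_eq_true] at h
  rcases h with h | h
  · obtain ⟨c, hc, d, hd, hMc, hMd, hcd⟩ := hB.exists_of_hasEdge h
    rw [Nat.testBit_and, Bool.and_eq_true, testBit_trace ‹_›, hB.adj i hi _ ‹_›] at hMc hMd
    exact not_adj_of_k4_free hK hxi hMc.1 hMd.1 hMc.2 hMd.2 hcd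
  have hR : ∀ c, (without (without (2 ^ a.length - 1) (trace G f a.length x))
      (a.getD i 0)).testBit c = true ↔ c < a.length ∧ ¬ G.Adj x (f c) ∧ ¬ G.Adj (f i) (f c) := by
    intro c
    rw [testBit_without, testBit_complement_trace, and_assoc]
    exact and_congr_right fun hc => and_congr_right fun _ => not_congr (hB.adj i hi c hc)
  obtain ⟨c, hc, h⟩ := any_zipIdx.1 h
  rw [Bool.and_eq_true, Bool.and_eq_true, hR, any_zipIdx] at h
  obtain ⟨⟨-, hxc, hic⟩, -, d, hd, h⟩ := h
  rw [Bool.and_eq_true, Bool.or_eq_true, Nat.testBit_and, Bool.and_eq_true, hR, hB.adj c hc d hd,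
    bne_zero_iff, bne_zero_iff] at h
  obtain ⟨⟨⟨-, hxd, hid⟩, hcd⟩, ⟨j, hj⟩ | ⟨j, hj⟩⟩ := h
  · simp only [testBit_without, Nat.testBit_xor, bne_iff_ne, Nat.testBit_two_pow,
      decide_eq_true_eq] at hj
    obtain ⟨⟨⟨hj, hij⟩, hcj⟩, hdj⟩ := hj
    have hjl : j < a.length := by
      by_contra hjl
      have h1 := mt (lt_of_testBit (trace_lt (G := G) (f := f) a.length x)) hjl
      have h2 := mt (lt_of_testBit (hB.lt i hi)) hjl
      rw [Bool.not_eq_true] at h1 h2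
      exact hj (h1.trans h2.symm)
    have hne : f i ≠ f j := fun h => hij (hB.inj i hi j hjl h)
    rw [hB.adj c hc j hjl, G.adj_comm] at hcj
    rw [hB.adj d hd j hjl, G.adj_comm] at hdj
    rw [ne_eq, Bool.eq_iff_iff, testBit_trace hjl, hB.adj i hi j hjl] at hj
    by_cases hxj : G.Adj x (f j)
    · exact not_adj_of_p3p2_free hP hxi.symm hxj hne (fun h => hj (iff_of_true hxj h))
        hic hid hxc hxd hcj hdj hcd
    · exact not_adj_of_p3p2_free hP hxi (not_not.1 fun h => hj (iff_of_false hxj h))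
        (hx j hjl).symm hxj hxc hxd hic hid hcj hdj hcd
  · simp only [testBit_without, Nat.testBit_and, Bool.and_eq_true, hR, Nat.testBit_two_pow,
      decide_eq_true_eq] at hj
    obtain ⟨⟨⟨⟨hjl, hxj, hij⟩, hdj⟩, hcj⟩, hne⟩ := hj
    rw [hB.adj d hd j hjl] at hdj
    rw [hB.adj c hc j hjl] at hcj
    exact not_adj_of_p3p2_free hP hcd hdj (fun h => hne (hB.inj c hc j hjl h)) hcj
      (mt G.adj_symm hxc) (mt G.adj_symm hic) (mt G.adj_symm hxd) (mt G.adj_symm hid)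
      (mt G.adj_symm hxj) (mt G.adj_symm hij) hxi

theorem IsBase.not_completes (hP : ¬ Contains G P3P2) (hK : ¬ Contains G (completeGraph (Fin 4)))
    (hB : IsBase G f a) (hx : IsNew f a.length x) :
    completes a (trace G f a.length x) = false := by
  rw [← Bool.not_eq_true, completes, List.any_eq_true]
  rintro ⟨i, hi, h⟩
  rw [List.mem_range] at hi
  rw [Bool.and_eq_true, testBit_trace hi] at h
  exact Bool.false_ne_true ((hB.not_clashes hP hK hx hi h.1).symm.trans h.2)

/-- The graph coded by `a` is embedded by `f`, the traces of all other vertices are in `T`, and no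
two of them whose traces form a pair in `no` are adjacent. -/
structure IsState (G : SimpleGraph V) (f : ℕ → V) (a T : List ℕ) (no : List (ℕ × ℕ × ℕ)) :
    Prop where
  base : IsBase G f a
  mem : ∀ x, IsNew f a.length x → trace G f a.length x ∈ T
  le : ∀ r ∈ no, r.1 ≤ a.length
  not_adj : ∀ r ∈ no, ∀ x y, IsNew f a.length x → IsNew f a.length y →
    trace G f r.1 x = r.2.1 → trace G f r.1 y = r.2.2 → ¬ G.Adj x y

theorem IsState.snoc (hP : ¬ Contains G P3P2) (hK : ¬ Contains G (completeGraph (Fin 4)))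
    (h : IsState G f a T no) (hx : IsNew f a.length x) :
    IsState G (Function.update f a.length x) (addRow a (trace G f a.length x))
      (extend (addRow a (trace G f a.length x)) T) no := by
  have hB := h.base.snoc hx
  refine ⟨hB, fun y hy => ?_, fun r hr => ?_, fun r hr y z hy hz hry hrz => ?_⟩
  · have hc := hB.not_completes hP hK hy
    have hc' := hB.not_clashes hP hK hy (i := a.length) (by rw [length_addRow]; omega)
    rw [length_addRow] at hy hc hc' ⊢
    rw [extend, List.mem_flatMap, length_addRow]
    refine ⟨_, h.mem y (isNew_update.1 hy).1, ?_⟩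
    rw [trace, trace_update le_rfl, Function.update_self] at *
    by_cases hyx : G.Adj y x <;> simp_all
  · rw [length_addRow]
    exact (h.le r hr).trans (Nat.le_succ _)
  · rw [length_addRow] at hy hz
    rw [trace_update (h.le r hr)] at hry hrz
    exact h.not_adj r hr y z (isNew_update.1 hy).1 (isNew_update.1 hz).1 hry hrz

theorem IsState.mayAdj (hP : ¬ Contains G P3P2) (hK : ¬ Contains G (completeGraph (Fin 4)))
    (h : IsState G f a T no) (hx : IsNew f a.length x) (hy : IsNew f a.length y)
    (hxy : G.Adj x y) :
    mayAdj a no (trace G f a.length x) (trace G f a.length y) = true := by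
  rw [TraceCert.mayAdj, Bool.and_eq_true, List.all_eq_true, eagerList_eq]
  constructor
  · intro r hr
    rw [trace_mod (h.le r hr), trace_mod (h.le r hr)]
    simp only [Bool.and_eq_true, Bool.not_eq_true', ← Bool.not_eq_true, beq_iff_eq]
    exact ⟨fun e => h.not_adj r hr x y hx hy e.1 e.2 hxy,
      fun e => h.not_adj r hr y x hy hx e.1 e.2 hxy.symm⟩
  · have := (h.base.snoc hx).not_clashes hP hK (x := y) (i := a.length)
      (by rw [length_addRow]; exact isNew_update.2 ⟨hy, hxy.ne⟩)
      (by rw [length_addRow]; omega) (by simpa using hxy.symm)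
    rw [length_addRow, trace_update_succ_of_adj hxy] at this
    rw [this]
    rfl

theorem IsBase.eq_of_isMatching (hP : ¬ Contains G P3P2)
    (hK : ¬ Contains G (completeGraph (Fin 4))) (hB : IsBase G f a)
    (hM : isMatching a (trace G f a.length x) = true) {z : V}
    (hxy : G.Adj x y) (hxz : G.Adj x z)
    (hy : trace G f a.length y = trace G f a.length x)
    (hz : trace G f a.length z = trace G f a.length x) : y = z := by
  by_contra hne
  rw [isMatching, Bool.and_eq_true, bne_zero_iff] at hM
  obtain ⟨⟨i, hxi⟩, hE⟩ := hM
  have hi := lt_of_testBit (trace_lt a.length x) hxi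
  have hyi := hxi
  have hzi := hxi
  rw [← hy] at hyi
  rw [← hz] at hzi
  rw [testBit_trace hi] at hxi hyi hzi
  by_cases hyz : G.Adj y z
  · exact not_adj_of_k4_free hK hxi.symm hyi.symm hzi.symm hxy hxz hyz
  obtain ⟨c, -, d, -, hc, hd, hcd⟩ := hB.exists_of_hasEdge hE
  have hcy := hc
  have hcz := hc
  have hdy := hd
  have hdz := hd
  rw [← hy] at hcy hdy
  rw [← hz] at hcz hdz
  rw [testBit_complement_trace] at hc hd hcy hdy hcz hdz
  exact not_adj_of_p3p2_free hP hxy.symm hxz hne hyz hcy.2 hdy.2 hc.2 hd.2 hcz.2 hdz.2 hcd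

theorem exists_mem_palette (n ds : ℕ) (ex : List (ℕ × ℕ)) {t : ℕ} (ht : t ∈ T) :
    ∃ u ∈ palette n ds ex T, u.1 = t ∧ u.2.1 < 7 ∧ u.2.2 < 7 := by
  obtain ⟨i, hi, rfl⟩ := List.getElem_of_mem ht
  refine ⟨_, List.mem_map.2 ⟨(T[i], n + i), ?_, rfl⟩, rfl, Nat.mod_lt _ (by omega),
    Nat.mod_lt _ (by omega)⟩
  rw [List.mk_mem_zipIdx_iff_le_and_getElem?_sub]
  simp [hi]

theorem IsState.colorable_of_isProper [Finite V] (hP : ¬ Contains G P3P2)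
    (hK : ¬ Contains G (completeGraph (Fin 4))) (h : IsState G f a T no) {ds : ℕ}
    {ex : List (ℕ × ℕ)} (hp : isProper ds ex a T no = true) : G.Colorable 7 := by
  classical
  obtain ⟨n, ⟨e⟩⟩ := Finite.exists_equiv_fin V
  simp only [isProper, Bool.and_eq_true, List.all_eq_true, List.mem_range, Bool.or_eq_true,
    Bool.not_eq_true', bne_iff_ne, decide_eq_true_eq] at hp
  obtain ⟨⟨⟨hbb, hbn⟩, hself⟩, hnn⟩ := hp
  have hpal := fun t (ht : t ∈ T) => exists_mem_palette a.length ds ex ht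
  choose! pal hpal using hpal
  choose! idx hidx using
    fun v (hv : ∃ i < a.length, f i = v) => hv
  let second : V → Prop := fun v => ∃ w, IsNew f a.length w ∧
    trace G f a.length w = trace G f a.length v ∧ G.Adj v w ∧ e w < e v
  let col : V → ℕ := fun v => if ∃ i < a.length, f i = v then digit ds (idx v) else
    if second v then (pal (trace G f a.length v)).2.2 else (pal (trace G f a.length v)).2.1
  have hnew : ∀ v, ¬ (∃ i < a.length, f i = v) → IsNew f a.length v :=
    fun v hv i hi hiv => hv ⟨i, hi, hiv⟩
  have hlt : ∀ v, col v < 7 := by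
    intro v
    simp only [col]
    split_ifs with hv
    · exact Nat.mod_lt _ (by omega)
    · exact (hpal _ (h.mem v (hnew v hv))).2.2.2
    · exact (hpal _ (h.mem v (hnew v hv))).2.2.1
  have hbase : ∀ v w, (∃ i < a.length, f i = v) → G.Adj v w → col v ≠ col w := by
    intro v w hv hvw
    obtain ⟨hi, hfi⟩ := hidx v hv
    by_cases hw : ∃ i < a.length, f i = w
    · obtain ⟨hj, hfj⟩ := hidx w hw
      simp only [col, if_pos hv, if_pos hw]
      have : bitAdj a (idx v) (idx w) = true :=
        (h.base.adj _ hi _ hj).2 (by rw [hfi, hfj]; exact hvw)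
      simpa [this] using hbb _ hi _ hj
    · obtain ⟨hm, ht, -⟩ := hpal _ (h.mem w (hnew w hw))
      have := hbn _ hi _ hm
      rw [ht, (testBit_trace hi).2 (by rw [hfi]; exact hvw.symm)] at this
      simp only [Bool.true_eq_false, false_or] at this
      simp only [col, if_pos hv, if_neg hw]
      split_ifs
      exacts [this.2, this.1]
  have hsame : ∀ v w, IsNew f a.length v → IsNew f a.length w → G.Adj v w →
      trace G f a.length v = trace G f a.length w → e v < e w →
      (pal (trace G f a.length v)).2.1 ≠ (pal (trace G f a.length v)).2.2 ∧
      ¬ second v ∧ second w := by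
    intro v w hv hw hvw ht hlt
    obtain ⟨hm, htv, -⟩ := hpal _ (h.mem v hv)
    have hmay := h.mayAdj hP hK hv hw hvw
    rw [← ht] at hmay
    have := hself _ hm
    rw [htv, hmay] at this
    simp only [Bool.true_eq_false, or_false] at this
    refine ⟨this.1, ?_, ⟨v, hv, ht, hvw.symm, hlt⟩⟩
    rintro ⟨z, hz, hzt, hvz, hez⟩
    obtain rfl := h.base.eq_of_isMatching hP hK this.2 hvw hvz ht.symm hzt
    exact lt_asymm hez hlt
  have hdiff : ∀ v w, IsNew f a.length v → IsNew f a.length w → G.Adj v w →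
      trace G f a.length v < trace G f a.length w →
      (if second v then (pal (trace G f a.length v)).2.2 else (pal (trace G f a.length v)).2.1) ≠
      if second w then (pal (trace G f a.length w)).2.2 else (pal (trace G f a.length w)).2.1 := by
    intro v w hv hw hvw hlt
    obtain ⟨hm, htv, -⟩ := hpal _ (h.mem v hv)
    obtain ⟨hm', htw, -⟩ := hpal _ (h.mem w hw)
    have := hnn _ hm _ hm'
    rw [htv, htw, h.mayAdj hP hK hv hw hvw] at this
    simp only [hlt.not_ge, Bool.true_eq_false, or_false, false_or] at this
    obtain ⟨⟨⟨h1, h2⟩, h3⟩, h4⟩ := this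
    split_ifs <;> assumption
  refine ⟨Coloring.mk (fun v => (⟨col v, hlt v⟩ : Fin 7)) fun {v w} hvw heq => ?_⟩
  have heq : col v = col w := congrArg Fin.val heq
  by_cases hv : ∃ i < a.length, f i = v
  · exact hbase v w hv hvw heq
  by_cases hw : ∃ i < a.length, f i = w
  · exact hbase w v hw hvw.symm heq.symm
  have hv' := hnew v hv
  have hw' := hnew w hw
  simp only [col, if_neg hv, if_neg hw] at heq
  by_cases ht : trace G f a.length v = trace G f a.length w
  · rcases lt_or_gt_of_ne (fun h => hvw.ne (e.injective h)) with hlt | hlt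
    · obtain ⟨h1, h2, h3⟩ := hsame v w hv' hw' hvw ht hlt
      rw [if_neg h2, if_pos h3, ← ht] at heq
      exact h1 heq
    · obtain ⟨h1, h2, h3⟩ := hsame w v hw' hv' hvw.symm ht.symm hlt
      rw [if_neg h2, if_pos h3, ht] at heq
      exact h1 heq.symm
  · rcases lt_or_gt_of_ne ht with hlt | hlt
    · exact hdiff v w hv' hw' hvw hlt heq
    · exact hdiff w v hw' hv' hvw.symm hlt heq.symm

theorem IsState.colorable_of_check [Finite V] (hP : ¬ Contains G P3P2)
    (hK : ¬ Contains G (completeGraph (Fin 4))) (C : Cert) (h : IsState G f a T no)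
    (hC : C.check a T no = true) : G.Colorable 7 := by
  induction C generalizing f a T no with
  | leaf ds ex => exact h.colorable_of_isProper hP hK hC
  | vert p yes no' ihy ihn =>
    simp only [Cert.check, eagerList_eq, Bool.and_eq_true] at hC
    by_cases hp : ∃ x, IsNew f a.length x ∧ trace G f a.length x = p
    · obtain ⟨x, hx, rfl⟩ := hp
      exact ihy (h.snoc hP hK hx) hC.1
    · refine ihn ⟨h.base, fun x hx => ?_, h.le, h.not_adj⟩ hC.2
      rw [List.mem_filter, bne_iff_ne]
      exact ⟨h.mem x hx, fun e => hp ⟨x, hx, e⟩⟩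
  | pair p q yes no' ihy ihn =>
    simp only [Cert.check, eagerList_eq, Bool.and_eq_true] at hC
    by_cases hp : ∃ x y, IsNew f a.length x ∧ IsNew f a.length y ∧
        trace G f a.length x = p ∧ trace G f a.length y = q ∧ G.Adj x y
    · obtain ⟨x, y, hx, hy, rfl, rfl, hxy⟩ := hp
      have hy' : IsNew (Function.update f a.length x) (addRow a (trace G f a.length x)).length y := by
        rw [length_addRow]
        exact isNew_update.2 ⟨hy, hxy.ne⟩
      have := (h.snoc hP hK hx).snoc hP hK hy'
      rw [length_addRow, trace_update_succ_of_adj hxy] at this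
      exact ihy this hC.1
    · refine ihn ⟨h.base, h.mem, ?_, ?_⟩ hC.2
      · rintro r (_ | ⟨_, hr⟩)
        exacts [le_rfl, h.le r hr]
      · rintro r (_ | ⟨_, hr⟩)
        · exact fun x y hx hy hxp hyq hxy => hp ⟨x, y, hx, hy, hxp, hyq, hxy⟩
        · exact h.not_adj r hr

theorem coDomino_adj : ∀ i j : Fin 6, (baseRows.getD i 0).testBit j = true ↔ coDomino.Adj i j := by
  intro i j
  fin_cases i <;> fin_cases j <;> simp [coDomino, baseRows, Nat.testBit]

theorem isState_of_coDomino (hP : ¬ Contains G P3P2)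
    (hK : ¬ Contains G (completeGraph (Fin 4))) (φ : coDomino ↪g G) :
    IsState G (fun i => if h : i < 6 then φ ⟨i, h⟩ else φ 0) baseRows
      ((List.range 64).filter fun t => !completes baseRows t) [] := by
  have hB : IsBase G (fun i => if h : i < 6 then φ ⟨i, h⟩ else φ 0) baseRows := by
    refine ⟨fun i (hi : i < 6) j (hj : j < 6) h => ?_, by decide, fun i (hi : i < 6) j (hj : j < 6) => ?_⟩
    · simp only [hi, hj, dif_pos] at h
      exact congrArg Fin.val (φ.injective h)
    · simp only [hi, hj, dif_pos, φ.map_adj_iff]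
      exact coDomino_adj ⟨i, hi⟩ ⟨j, hj⟩
  refine ⟨hB, fun x hx => ?_, by simp, by simp⟩
  rw [List.mem_filter, List.mem_range]
  exact ⟨trace_lt _ _, by rw [hB.not_completes hP hK hx]; rfl⟩

end TraceCert

theorem chromatic_le_seven_of_coDomino {V : Type*} [Fintype V] (G : SimpleGraph V)
    (hP : ¬ Contains G P3P2) (hK : ¬ Contains G (completeGraph (Fin 4)))
    (h : Contains G coDomino) :
    G.chromaticNumber ≤ 7 := by
  obtain ⟨φ⟩ := h
  exact_mod_cast ((TraceCert.isState_of_coDomino hP hK φ).colorable_of_check hP hK _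
    TraceCert.coDominoCert_check).chromaticNumber_le
end

section
/- Let G be a (P₃∪P₂, K₄, K₃∪P₂, co-domino, X₁, X₂)-free graph. If G contains co-twin-C₅, then χ(G) ≤ 7. -/
open SimpleGraph

/-! ### Finite adjacency matrices and a search for induced subgraphs -/

/-- The vector of length `n` with entry `true` exactly at the labels in `S`, where the labels
`0, …, n - 1` are listed in decreasing order. -/
def indicator (n : ℕ) (S : List ℕ) : List Bool :=
  (List.range n).reverse.map fun i => decide (i ∈ S)

/-- Border a symmetric matrix with a new first row and column `t`, and `false` in the corner. -/
def border (M : List (List Bool)) (t : List Bool) : List (List Bool) :=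
  (false :: t) :: List.zipWith List.cons t M

/-- The adjacency matrix, with labels in decreasing order, of the graph on `0, …, l.length - 1` in
which the neighbours of `i` that precede `i` are listed in the `i`-th entry of `l`. -/
def matrixOf (l : List (List ℕ)) : List (List Bool) :=
  l.foldl (fun M S => border M (indicator M.length S)) []

/-- The number whose binary digits, starting with the units, are the entries of `t`. -/
noncomputable def ofDigits (t : List Bool) : ℕ :=
  List.rec 0 (fun b _ n => Nat.add (cond b 1 0) (Nat.mul 2 n)) t

/-- The binary codes of the neighbourhood and of the set of proper nonneighbours of each vertex
in the graph with adjacency matrix `M`. -/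
noncomputable def codes (M : List (List Bool)) : List (ℕ × ℕ) :=
  M.zipIdx.map fun t => (ofDigits t.1, ofDigits ((t.1.map not).set t.2 false))

/-- The effect on `codes` of adding a new first vertex with adjacency vector `t`. -/
noncomputable def extend (R : List (ℕ × ℕ)) (t : List Bool) : List (ℕ × ℕ) :=
  (Nat.mul 2 (ofDigits t), Nat.mul 2 (ofDigits (t.map not))) :: List.zipWith
    (fun r b => (Nat.add (cond b 1 0) (Nat.mul 2 r.1), Nat.add (cond b 0 1) (Nat.mul 2 r.2))) R t

/-- Does `f` hold for an entry of `R` whose index is in the set with binary code `c`? -/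
noncomputable def anyIn {α : Type} (f : α → Bool) (R : List α) : ℕ → Bool :=
  List.rec (fun _ => false) (fun r _ ih c =>
    cond (Nat.beq (Nat.mod c 2) 1) (cond (f r) true (ih (Nat.div c 2))) (ih (Nat.div c 2))) R

/-- Intersect each set in `cs` with the set of neighbours or nonneighbours of the vertex with
codes `r`, as prescribed by `p`, and apply `k` to the result unless one of the sets is empty. -/
noncomputable def restrict (r : ℕ × ℕ) (p : List Bool) : List ℕ → (List ℕ → Bool) → Bool :=
  List.rec (fun _ k => k []) (fun b _ ih cs k => List.rec (k []) (fun c cs _ =>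
    cond (Nat.beq (Nat.land c (cond b r.1 r.2)) 0) false
      (ih cs fun cs => k (Nat.land c (cond b r.1 r.2) :: cs))) cs) p

/-- Search for an induced subgraph with upper triangular adjacency matrix `P` in the graph with
codes `R`, such that the vertices are in the sets with binary codes `cs`. -/
noncomputable def search (R : List (ℕ × ℕ)) (P : List (List Bool)) : List ℕ → Bool :=
  List.rec (fun _ => true) (fun p _ ih cs => List.rec false (fun c cs _ =>
    anyIn (fun r => restrict r p cs ih) R c) cs) P

/-- The upper triangular adjacency matrix of the graph on `0, …, l.length - 1` in which the
neighbours of `i` that follow `i` are listed in the `i`-th entry of `l`. -/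
def upperMatrixOf (l : List (List ℕ)) : List (List Bool) :=
  l.zipIdx.map fun S =>
    (List.range (l.length - 1 - S.2)).map fun j => decide (S.2 + 1 + j ∈ S.1)

/-- The adjacency matrices of the six forbidden induced subgraphs. -/
def forbidden : List (List (List Bool)) :=
  [upperMatrixOf [[1, 2, 3], [2, 3], [3], []],
   upperMatrixOf [[1], [2], [], [4], []],
   upperMatrixOf [[1, 2], [2], [], [4], []],
   upperMatrixOf [[1, 4, 5], [2, 3], [3], [4], [5], []],
   upperMatrixOf [[1, 2, 5, 6], [2], [3], [4], [5, 6], [], []],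
   upperMatrixOf [[1, 2, 5], [2, 6], [3, 5], [4, 5], [5, 6], [], []]]

/-- Does the graph with codes `R` contain a forbidden induced subgraph? -/
noncomputable def hasForbidden (R : List (ℕ × ℕ)) : Bool :=
  forbidden.any fun P => search R P (P.map fun _ => ofDigits (R.map fun _ => true))

/-- Does `f` hold for every pair of entries of `L`, in the order in which they appear? -/
def allPairs {α : Type} (f : α → α → Bool) : List α → Bool
  | [] => true
  | t :: L => (t :: L).all (f t) && allPairs f L

/-- Check that vertices whose rows over `M` lie in `L` are pairwise nonadjacent. -/
noncomputable def indepCheck (M L : List (List Bool)) : Bool :=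
  allPairs (fun t s => hasForbidden (extend (extend (codes M) t) (true :: s))) L &&
  (List.range M.length).all fun i => !decide (M.getD i [] ∈ L) || L.all fun s => !s.getD i false

/-- All vectors of length `n`. -/
def allVectors : ℕ → List (List Bool)
  | 0 => [[]]
  | n + 1 => (allVectors n).flatMap fun t => [false :: t, true :: t]

/-- Check that the row of every vertex over `M` satisfies `p`. -/
noncomputable def rowCheck (M : List (List Bool)) (p : List Bool → Bool) : Bool :=
  ((allVectors M.length).all fun t => p t || hasForbidden (extend (codes M) t)) && M.all p

theorem mem_allVectors (t : List Bool) : t ∈ allVectors t.length := by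
  induction t with
  | nil => simp [allVectors]
  | cons b t ih =>
    simp only [List.length_cons, allVectors, List.mem_flatMap]
    exact ⟨t, ih, by cases b <;> simp⟩

theorem ofDigits_cons (b : Bool) (t : List Bool) : ofDigits (b :: t) = Nat.bit b (ofDigits t) := by
  cases b <;> simp [ofDigits, Nat.bit, Nat.add_comm]

theorem or_of_allPairs {α : Type} {f : α → α → Bool} {L : List α} (h : allPairs f L = true)
    {s t : α} (hs : s ∈ L) (ht : t ∈ L) : f s t = true ∨ f t s = true := by
  induction L with
  | nil => simp at hs
  | cons a L ih =>
    rw [allPairs, Bool.and_eq_true, List.all_eq_true] at h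
    rcases List.mem_cons.mp hs with rfl | hs'
    · exact Or.inl (h.1 t ht)
    · rcases List.mem_cons.mp ht with rfl | ht'
      · exact Or.inr (h.1 s hs)
      · exact ih h.2 hs' ht'

theorem of_restrict {r : ℕ × ℕ} {p : List Bool} {cs : List ℕ} {k : List ℕ → Bool}
    (h : restrict r p cs k = true) :
    k (List.zipWith (fun b c => Nat.land c (cond b r.1 r.2)) p cs) = true := by
  induction p generalizing cs k with
  | nil => exact h
  | cons b p ih =>
    cases cs with
    | nil => exact h
    | cons c cs =>
      change cond (Nat.beq (Nat.land c (cond b r.1 r.2)) 0) false (restrict r p cs fun cs =>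
        k (Nat.land c (cond b r.1 r.2) :: cs)) = true at h
      rcases hc : Nat.beq (Nat.land c (cond b r.1 r.2)) 0
      · rw [hc] at h
        exact ih h
      · rw [hc] at h
        exact (Bool.false_ne_true h).elim

section

variable {V : Type*} {G : SimpleGraph V}

open Classical in
/-- The binary code of the set of members of `vs` that satisfy `p`. -/
noncomputable def code (vs : List V) (p : V → Prop) : ℕ := ofDigits (vs.map fun v => decide (p v))

theorem code_cons (v : V) (vs : List V) (p : V → Prop) [Decidable (p v)] :
    code (v :: vs) p = Nat.bit (decide (p v)) (code vs p) := by
  rw [code, List.map_cons, ofDigits_cons, code]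
  congr

theorem land_code (vs : List V) (p q : V → Prop) :
    code vs p &&& code vs q = code vs fun v => p v ∧ q v := by
  classical
  induction vs with
  | nil => exact Nat.zero_and 0
  | cons v vs ih =>
    rw [code_cons, code_cons, code_cons, ← ih, Bool.decide_and]
    exact Nat.land_bit ..

theorem exists_of_anyIn {α : Type} {f : α → Bool} {g : V → α} {vs : List V} {p : V → Prop}
    (h : anyIn f (vs.map g) (code vs p) = true) : ∃ v ∈ vs, p v ∧ f (g v) = true := by
  classical
  induction vs with
  | nil => exact (Bool.false_ne_true h).elim
  | cons v vs ih =>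
    change cond (Nat.beq (code (v :: vs) p % 2) 1) (cond (f (g v)) true
      (anyIn f (vs.map g) (code (v :: vs) p / 2))) (anyIn f (vs.map g)
      (code (v :: vs) p / 2)) = true at h
    rw [code_cons, Nat.bit_div_two, Nat.bit_mod_two] at h
    by_cases hv : p v ∧ f (g v) = true
    · exact ⟨v, List.mem_cons_self, hv⟩
    · obtain ⟨u, hu, hu'⟩ := ih (by
        by_cases hp : p v
        · have hf := Bool.eq_false_iff.mpr fun e => hv ⟨hp, e⟩
          simpa [hp, hf] using h
        · simpa [hp] using h)
      exact ⟨u, List.mem_cons_of_mem v hu, hu'⟩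

/-- The codes of the neighbourhood and of the set of proper nonneighbours of `x` in `vs`. -/
noncomputable def vertexCode (G : SimpleGraph V) (vs : List V) (x : V) : ℕ × ℕ :=
  (code vs (G.Adj x), code vs fun y => ¬ G.Adj x y ∧ y ≠ x)

/-- The vertices in `xs` are distinct and have upper triangular adjacency matrix `P`. -/
def Realizes (G : SimpleGraph V) : List (List Bool) → List V → Prop
  | [], xs => xs = []
  | p :: P, xs => ∃ x ys, xs = x :: ys ∧ Realizes G P ys ∧ ∀ i (hi : i < ys.length),
      x ≠ ys[i] ∧ (G.Adj x ys[i] ↔ p.getD i false = true)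

theorem Realizes.length_eq {P : List (List Bool)} {xs : List V} (h : Realizes G P xs) :
    xs.length = P.length := by
  induction P generalizing xs with
  | nil => simp [show xs = [] from h]
  | cons p P ih =>
    obtain ⟨x, ys, rfl, h, -⟩ := h
    simp [ih h]

theorem Realizes.adj_iff {P : List (List Bool)} {xs : List V} (h : Realizes G P xs) {i j : ℕ}
    (hij : i < j) (hj : j < xs.length) : xs[i] ≠ xs[j] ∧
      (G.Adj xs[i] xs[j] ↔ (P.getD i []).getD (j - i - 1) false = true) := by
  induction P generalizing xs i j with
  | nil =>
    obtain rfl : xs = [] := h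
    simp at hj
  | cons p P ih =>
    obtain ⟨x, ys, rfl, h, hx⟩ := h
    obtain ⟨j, rfl⟩ : ∃ k, j = k + 1 := ⟨j - 1, by omega⟩
    rw [List.length_cons, Nat.add_lt_add_iff_right] at hj
    cases i with
    | zero => simpa using hx j hj
    | succ i =>
      have := ih h (Nat.lt_of_succ_lt_succ hij) hj
      simpa [Nat.add_sub_add_right] using this

theorem Realizes.contains {n : ℕ} {H : SimpleGraph (Fin n)} {P : List (List Bool)} {xs : List V}
    (h : Realizes G P xs) (hn : P.length = n)
    (hP : ∀ i j : Fin n, i < j → (H.Adj i j ↔ (P.getD i []).getD (j - i - 1) false = true)) :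
    Contains G H := by
  have hlt (i : Fin n) : i < xs.length := by rw [h.length_eq, hn]; exact i.2
  have hadj (i j : Fin n) (hij : i < j) : xs[i]'(hlt i) ≠ xs[j]'(hlt j) ∧
      (G.Adj (xs[i]'(hlt i)) (xs[j]'(hlt j)) ↔ H.Adj i j) := by
    rw [hP i j hij]
    exact h.adj_iff hij (hlt j)
  refine ⟨⟨⟨fun i => xs[i]'(hlt i), fun i j e => ?_⟩, fun {i j} => ?_⟩⟩
  · rcases lt_trichotomy i j with hij | hij | hij
    · exact ((hadj i j hij).1 e).elim
    · exact hij
    · exact ((hadj j i hij).1 e.symm).elim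
  · rcases lt_trichotomy i j with hij | rfl | hij
    · exact (hadj i j hij).2
    · simp
    · rw [G.adj_comm, H.adj_comm]
      exact (hadj j i hij).2

theorem exists_realizes_of_search {vs : List V} {P : List (List Bool)} {qs : List (V → Prop)}
    (h : search (vs.map (vertexCode G vs)) P (qs.map (code vs)) = true) :
    ∃ xs, Realizes G P xs ∧ ∀ i (hi : i < xs.length), ∃ hq : i < qs.length, qs[i] xs[i] := by
  induction P generalizing qs with
  | nil => exact ⟨[], rfl, by simp⟩
  | cons p P ih =>
    cases qs with
    | nil => exact (Bool.false_ne_true h).elim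
    | cons q qs =>
      obtain ⟨x, -, hqx, h⟩ := exists_of_anyIn (f := fun r => restrict r p (qs.map (code vs))
        (search (vs.map (vertexCode G vs)) P)) h
      have h := of_restrict h
      have key : List.zipWith
          (fun b c => Nat.land c (cond b (vertexCode G vs x).1 (vertexCode G vs x).2)) p
          (qs.map (code vs)) = (List.zipWith (fun b q => fun y => q y ∧
            if b = true then G.Adj x y else ¬ G.Adj x y ∧ y ≠ x) p qs).map (code vs) := by
        rw [List.zipWith_map_right, List.map_zipWith]
        congr 1
        funext b q
        cases b
        · exact land_code vs q fun y => ¬ G.Adj x y ∧ y ≠ x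
        · exact land_code vs q (G.Adj x)
      rw [key] at h
      obtain ⟨ys, hys, hqs⟩ := ih h
      refine ⟨x :: ys, ⟨x, ys, rfl, hys, fun i hi => ?_⟩, fun i hi => ?_⟩
      · obtain ⟨hq, h⟩ := hqs i hi
        simp only [List.length_zipWith, lt_min_iff] at hq
        simp only [List.getElem_zipWith] at h
        rw [List.getD_eq_getElem _ _ hq.1]
        have h := h.2
        split_ifs at h with hb
        · exact ⟨h.ne, by simp [h, hb]⟩
        · exact ⟨h.2.symm, by simp [h.1, hb]⟩
      · cases i with
        | zero => exact ⟨by simp, hqx⟩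
        | succ i =>
          obtain ⟨hq, h⟩ := hqs i (by simpa using hi)
          simp only [List.length_zipWith, lt_min_iff] at hq
          simp only [List.getElem_zipWith] at h
          exact ⟨by simpa using hq.2, h.1⟩

/-- `G` has none of the six forbidden induced subgraphs. -/
structure IsFree (G : SimpleGraph V) : Prop where
  p3p2 : ¬ Contains G P3P2
  k4 : ¬ Contains G (completeGraph (Fin 4))
  k3p2 : ¬ Contains G K3P2
  coDomino : ¬ Contains G coDomino
  x1 : ¬ Contains G X1
  x2 : ¬ Contains G X2

theorem IsFree.hasForbidden_eq_false (hG : IsFree G) (vs : List V) :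
    hasForbidden (vs.map (vertexCode G vs)) = false := by
  rw [Bool.eq_false_iff]
  intro h
  obtain ⟨P, hP, hs⟩ := List.any_eq_true.mp h
  have htop : ofDigits ((vs.map (vertexCode G vs)).map fun _ => true) =
      code vs fun _ => True := by
    simp [code]
  rw [htop, show (P.map fun _ => code vs fun _ => True) =
    (P.map fun _ => fun _ => True).map (code vs) by simp] at hs
  obtain ⟨xs, hxs, -⟩ := exists_realizes_of_search hs
  simp only [forbidden, List.mem_cons, List.not_mem_nil, or_false] at hP
  rcases hP with rfl | rfl | rfl | rfl | rfl | rfl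
  · exact hG.k4 (hxs.contains rfl (by simp only [completeGraph, top_adj]; decide))
  · exact hG.p3p2 (hxs.contains rfl (by simp only [P3P2, fromEdgeSet_adj]; decide))
  · exact hG.k3p2 (hxs.contains rfl (by simp only [K3P2, fromEdgeSet_adj]; decide))
  · exact hG.coDomino (hxs.contains rfl (by
      simp only [_root_.coDomino, fromEdgeSet_adj]; decide))
  · exact hG.x1 (hxs.contains rfl (by simp only [X1, fromEdgeSet_adj]; decide))
  · exact hG.x2 (hxs.contains rfl (by simp only [X2, fromEdgeSet_adj]; decide))

open Classical in
/-- The adjacency vector of the vertex `x` over the list `vs`. -/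
noncomputable def row (G : SimpleGraph V) (vs : List V) (x : V) : List Bool :=
  vs.map fun v => decide (G.Adj x v)

/-- The adjacency matrix of the list of vertices `vs`. -/
noncomputable def matrix (G : SimpleGraph V) (vs : List V) : List (List Bool) :=
  vs.map (row G vs)

theorem row_cons (vs : List V) (x y : V) [Decidable (G.Adj y x)] :
    row G (x :: vs) y = decide (G.Adj y x) :: row G vs y := by
  simp [row]

theorem matrix_cons (vs : List V) (x : V) :
    matrix G (x :: vs) = border (matrix G vs) (row G vs x) := by
  simp [matrix, border, row, List.zipWith_map, List.zipWith_self, G.adj_comm]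

theorem getD_row {vs : List V} {i : ℕ} (hi : i < vs.length) (x : V) :
    (row G vs x).getD i false = true ↔ G.Adj x vs[i] := by
  simp [row, List.getD_eq_getElem?_getD, hi]

theorem getD_matrix {vs : List V} {i : ℕ} (hi : i < vs.length) :
    (matrix G vs).getD i [] = row G vs vs[i] := by
  simp [matrix, List.getD_eq_getElem?_getD, hi]

theorem codes_matrix {vs : List V} (hvs : vs.Nodup) :
    codes (matrix G vs) = vs.map (vertexCode G vs) := by
  classical
  refine List.ext_getElem (by simp [codes, matrix]) fun i hi hi' => ?_
  rw [List.length_map] at hi'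
  simp only [codes, matrix, row, vertexCode, code, List.getElem_map, List.getElem_zipIdx]
  refine Prod.ext ?_ ?_
  · simp
  · dsimp only
    congr 1
    refine List.ext_getElem (by simp) fun j hj hj' => ?_
    rw [List.length_map] at hj'
    by_cases hij : i = j
    · subst hij
      simp
    · simp [hij, hvs.getElem_inj_iff, Ne.symm hij]

theorem extend_codes {vs : List V} {x : V} (hx : x ∉ vs) :
    extend (vs.map (vertexCode G vs)) (row G vs x) =
      (x :: vs).map (vertexCode G (x :: vs)) := by
  classical
  have hne (y : V) (hy : y ∈ vs) : y ≠ x := fun e => hx (e ▸ hy)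
  have hbit (b : Bool) (n : ℕ) : Nat.add (cond b 1 0) (Nat.mul 2 n) = Nat.bit b n := by
    cases b <;> simp [Nat.bit, Nat.add_comm]
  have hbit' (b : Bool) (n : ℕ) : Nat.add (cond b 0 1) (Nat.mul 2 n) = Nat.bit (!b) n := by
    cases b <;> simp [Nat.bit, Nat.add_comm]
  simp only [extend, hbit, hbit', List.map_cons, vertexCode, row, List.zipWith_map,
    List.zipWith_self, code_cons]
  congr 1
  · refine Prod.ext ?_ ?_
    · simp [code, Nat.bit]
    · simp only [code, Nat.bit, List.map_map]
      simp
      congr 1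
      refine List.map_congr_left fun y hy => ?_
      simp [hne y hy]
  · refine List.map_congr_left fun y hy => ?_
    rw [vertexCode, code_cons, code_cons]
    simp [G.adj_comm x y, (hne y hy).symm]

theorem IsFree.isIndepSet_of_indepCheck (hG : IsFree G) {vs : List V} (hvs : vs.Nodup)
    {M L : List (List Bool)} (hM : matrix G vs = M) (h : indepCheck M L = true) :
    G.IsIndepSet {x | row G vs x ∈ L} := by
  subst hM
  rw [indepCheck, Bool.and_eq_true, codes_matrix hvs] at h
  obtain ⟨h₁, h₂⟩ := h
  have not_mem (x y : V) (hx : row G vs x ∈ L) (hy : row G vs y ∈ L) (hxy : G.Adj y x) :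
      x ∉ vs := by
    intro hxv
    obtain ⟨i, hi, rfl⟩ := List.getElem_of_mem hxv
    have := List.all_eq_true.mp h₂ i (by simpa [matrix] using hi)
    rw [getD_matrix hi, decide_eq_true hx, Bool.not_true, Bool.false_or] at this
    have := List.all_eq_true.mp this _ hy
    rw [(getD_row hi y).mpr hxy] at this
    exact Bool.false_ne_true this
  have key (x y : V) (hx : row G vs x ∈ L) (hy : row G vs y ∈ L) (hxy : G.Adj y x) :
      hasForbidden (extend (extend (vs.map (vertexCode G vs)) (row G vs x))
        (true :: row G vs y)) = false := by
    classical
    have hyv : y ∉ x :: vs := by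
      simpa using ⟨hxy.ne, not_mem y x hy hx hxy.symm⟩
    rw [← decide_eq_true hxy, ← row_cons, extend_codes (not_mem x y hx hy hxy), extend_codes hyv]
    exact hG.hasForbidden_eq_false _
  intro x hx y hy _ hxy
  have h := or_of_allPairs h₁ hx hy
  rw [key x y hx hy hxy.symm, key y x hy hx hxy] at h
  simp at h

theorem IsFree.row_of_rowCheck (hG : IsFree G) {vs : List V} (hvs : vs.Nodup)
    {M : List (List Bool)} (hM : matrix G vs = M) {p : List Bool → Bool}
    (h : rowCheck M p = true) (x : V) : p (row G vs x) = true := by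
  subst hM
  rw [rowCheck, Bool.and_eq_true, codes_matrix hvs] at h
  by_cases hx : x ∈ vs
  · exact List.all_eq_true.mp h.2 _ (List.mem_map_of_mem hx)
  · have := List.all_eq_true.mp h.1 (row G vs x) (by
      simpa [matrix, row] using mem_allVectors (row G vs x))
    rw [extend_codes hx, hG.hasForbidden_eq_false, Bool.or_false] at this
    exact this

/-! ### Covering by independent sets -/

/-- `S` is covered by two independent sets. -/
def IsBipartiteOn (G : SimpleGraph V) (S : Set V) : Prop :=
  ∃ A B : Set V, G.IsIndepSet A ∧ G.IsIndepSet B ∧ S ⊆ A ∪ B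

theorem colorable_of_isIndepSet_cover {n : ℕ} (A : Fin n → Set V)
    (hA : ∀ i, G.IsIndepSet (A i)) (hcov : ∀ x, ∃ i, x ∈ A i) : G.Colorable n := by
  choose c hc using hcov
  exact ⟨Coloring.mk c fun {x y} hxy e => hA (c x) (hc x) (e ▸ hc y) hxy.ne hxy⟩

theorem colorable_seven_of_cover {S₁ S₂ S₃ S₄ : Set V} (h₁ : IsBipartiteOn G S₁)
    (h₂ : IsBipartiteOn G S₂) (h₃ : IsBipartiteOn G S₃) (h₄ : G.IsIndepSet S₄)
    (hcov : ∀ x, x ∈ S₁ ∨ x ∈ S₂ ∨ x ∈ S₃ ∨ x ∈ S₄) : G.Colorable 7 := by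
  obtain ⟨A₁, B₁, hA₁, hB₁, h₁⟩ := h₁
  obtain ⟨A₂, B₂, hA₂, hB₂, h₂⟩ := h₂
  obtain ⟨A₃, B₃, hA₃, hB₃, h₃⟩ := h₃
  refine colorable_of_isIndepSet_cover ![A₁, B₁, A₂, B₂, A₃, B₃, S₄] (fun i => ?_) fun x => ?_
  · fin_cases i <;> assumption
  · rcases hcov x with hx | hx | hx | hx
    · rcases h₁ hx with hx | hx
      exacts [⟨0, hx⟩, ⟨1, hx⟩]
    · rcases h₂ hx with hx | hx
      exacts [⟨2, hx⟩, ⟨3, hx⟩]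
    · rcases h₃ hx with hx | hx
      exacts [⟨4, hx⟩, ⟨5, hx⟩]
    · exact ⟨6, hx⟩

/-- A set inducing a graph of maximum degree at most one is bipartite. -/
theorem isBipartiteOn_of_subsingleton_neighbors {S : Set V}
    (h : ∀ x ∈ S, ∀ y ∈ S, ∀ z ∈ S, G.Adj x y → G.Adj x z → y = z) : IsBipartiteOn G S := by
  let _ : LinearOrder V := WellOrderingRel.isWellOrder.linearOrder
  refine ⟨{x | x ∈ S ∧ ∃ y ∈ S, G.Adj x y ∧ x < y}, {x | x ∈ S ∧ ∀ y ∈ S, G.Adj x y → y < x},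
    ?_, ?_, fun x hx => ?_⟩
  · rintro x ⟨hx, x', hx', hxx', hlt⟩ y ⟨hy, y', hy', hyy', hlt'⟩ _ hxy
    obtain rfl := h x hx x' hx' y hy hxx' hxy
    obtain rfl := h x' hy y' hy' x hx hyy' hxy.symm
    exact lt_asymm hlt hlt'
  · rintro x ⟨hx, hx'⟩ y ⟨hy, hy'⟩ _ hxy
    exact lt_asymm (hx' y hy hxy) (hy' x hx hxy.symm)
  · by_cases hex : ∃ y ∈ S, G.Adj x y ∧ x < y
    · exact Or.inl ⟨hx, hex⟩
    · push Not at hex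
      exact Or.inr ⟨hx, fun y hy hxy => lt_of_le_of_ne (hex y hy hxy) hxy.ne'⟩

theorem IsFree.isBipartiteOn_nonneighbors (hG : IsFree G) {a b : V} (hab : G.Adj a b) :
    IsBipartiteOn G {x | ¬ G.Adj x a ∧ ¬ G.Adj x b} := by
  refine isBipartiteOn_of_subsingleton_neighbors ?_
  rintro x ⟨hxa, hxb⟩ y ⟨hya, hyb⟩ z ⟨hza, hzb⟩ hxy hxz
  by_contra hyz
  have hnd : [z, y, x, b, a].Nodup := by
    simp only [List.nodup_cons, List.mem_cons, List.not_mem_nil, or_false, not_or,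
      not_false_eq_true, List.nodup_nil, and_true]
    refine ⟨⟨Ne.symm hyz, hxz.ne', ?_, ?_⟩, ⟨hxy.ne', ?_, ?_⟩, ⟨?_, ?_⟩, hab.ne'⟩ <;> rintro rfl
    exacts [hza hab.symm, hzb hab, hya hab.symm, hyb hab, hxa hab.symm, hxb hab]
  have hf := hG.hasForbidden_eq_false [z, y, x, b, a]
  rw [← codes_matrix hnd] at hf
  have hax := mt (G.adj_symm (u := a) (v := x)) hxa
  have hbx := mt (G.adj_symm (u := b) (v := x)) hxb
  have hay := mt (G.adj_symm (u := a) (v := y)) hya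
  have hby := mt (G.adj_symm (u := b) (v := y)) hyb
  have haz := mt (G.adj_symm (u := a) (v := z)) hza
  have hbz := mt (G.adj_symm (u := b) (v := z)) hzb
  by_cases h : G.Adj y z
  · have hM : matrix G [z, y, x, b, a] = matrixOf [[], [0], [], [2], [2, 3]] := by
      simp only [matrix, row, List.map_cons, List.map_nil, hab, hab.symm, hxa, hxb, hya, hyb, hza,
        hzb, hax, hbx, hay, hby, haz, hbz, hxy, hxz, hxy.symm, hxz.symm, h, h.symm, G.irrefl]
      decide
    rw [hM] at hf
    revert hf
    decide +kernel
  · have h' := mt (G.adj_symm (u := z) (v := y)) h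
    have hM : matrix G [z, y, x, b, a] = matrixOf [[], [0], [], [2], [2]] := by
      simp only [matrix, row, List.map_cons, List.map_nil, hab, hab.symm, hxa, hxb, hya, hyb, hza,
        hzb, hax, hbx, hay, hby, haz, hbz, hxy, hxz, hxy.symm, hxz.symm, h, h', G.irrefl]
      decide
    rw [hM] at hf
    revert hf
    decide +kernel

/-! ### The neighbourhoods of a co-twin-`C₅` -/

/-- The vectors of length `n` that are the indicators of the members of `L`. -/
def vectors (n : ℕ) (L : List (List ℕ)) : List (List Bool) := L.map (indicator n)

/-- The adjacency lists of co-twin-`C₅`. -/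
def core : List (List ℕ) := [[], [0], [1], [2], [0, 3], [2, 3, 4]]

/-- The adjacency lists of co-twin-`C₅` together with two nonadjacent vertices whose
neighbourhoods in it are `{0, 3}` and `{1, 3}`. -/
def extendedCore : List (List ℕ) := core ++ [[0, 3], [1, 3]]

/-- The possible neighbourhoods in co-twin-`C₅` that contain the vertex `3` but not `5`. -/
def sideVectors : List (List Bool) :=
  vectors 6 [[0, 3], [1, 3], [0, 2, 3], [1, 3, 4], [0, 2, 3, 4], [1, 2, 3, 4], [0, 1, 2, 3, 4],
    [2, 3, 4]]

theorem IsFree.isBipartiteOn_of_indepCheck (hG : IsFree G) {vs : List V} (hvs : vs.Nodup)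
    {M : List (List Bool)} (hM : matrix G vs = M) (A B : List (List Bool))
    (hA : indepCheck M A = true) (hB : indepCheck M B = true) :
    IsBipartiteOn G {x | row G vs x ∈ A ∨ row G vs x ∈ B} :=
  ⟨_, _, hG.isIndepSet_of_indepCheck hvs hM hA, hG.isIndepSet_of_indepCheck hvs hM hB,
    fun _ hx => hx⟩

theorem IsFree.colorable_seven_of_classes (hG : IsFree G) {vs : List V} (hvs : vs.Nodup)
    {M : List (List Bool)} (hM : matrix G vs = M) (i j : ℕ) (A B C D E : List (List Bool))
    (hij : (decide (i < M.length) && decide (j < M.length) && (M.getD i []).getD j false) = true)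
    (hA : indepCheck M A = true) (hB : indepCheck M B = true) (hC : indepCheck M C = true)
    (hD : indepCheck M D = true) (hE : indepCheck M E = true)
    (hcov : rowCheck M (fun t => !t.getD i false && !t.getD j false ||
      decide (t ∈ A ∨ t ∈ B ∨ t ∈ C ∨ t ∈ D ∨ t ∈ E)) = true) : G.Colorable 7 := by
  have hlen : M.length = vs.length := by simp [← hM, matrix]
  rw [hlen, Bool.and_eq_true, Bool.and_eq_true, decide_eq_true_eq, decide_eq_true_eq] at hij
  obtain ⟨⟨hi, hj⟩, hij⟩ := hij
  rw [← hM, getD_matrix hi, getD_row hj] at hij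
  refine colorable_seven_of_cover (hG.isBipartiteOn_nonneighbors hij)
    (hG.isBipartiteOn_of_indepCheck hvs hM A B hA hB)
    (hG.isBipartiteOn_of_indepCheck hvs hM C D hC hD)
    (hG.isIndepSet_of_indepCheck hvs hM hE) fun x => ?_
  have hx := hG.row_of_rowCheck hvs hM hcov x
  rw [Bool.or_eq_true, Bool.and_eq_true, Bool.not_eq_true', Bool.not_eq_true', decide_eq_true_eq,
    Bool.eq_false_iff, Bool.eq_false_iff, ne_eq, ne_eq, getD_row hi, getD_row hj] at hx
  simp only [Set.mem_ofPred_eq]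
  tauto

theorem IsFree.colorable_seven_of_adj_zero_two_three_four (hG : IsFree G) {vs : List V}
    (hvs : vs.Nodup)
    (hM : matrix G vs = matrixOf (extendedCore ++ [[0, 2, 3, 4, 6, 7]])) : G.Colorable 7 :=
  hG.colorable_seven_of_classes hvs hM 8 7
    (vectors 9
      [[1, 2, 4, 5, 6, 7, 8], [1, 2, 4, 5, 6, 8], [1, 4, 5, 6, 7], [1, 4, 5, 6, 7, 8],
       [1, 4, 5, 6, 8], [1, 4, 6, 8], [1, 5, 6, 8]])
    (vectors 9 [[0, 2, 4, 5, 6, 7], [0, 2, 5, 6, 7], [0, 2, 5, 7, 8], [0, 2, 7]])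
    (vectors 9
      [[0, 1, 3, 5, 8], [0, 3, 5, 7], [0, 3, 5, 8], [0, 3, 8], [0, 5, 7, 8], [1, 3, 5, 8]])
    (vectors 9
      [[0, 1, 2, 3, 4], [0, 1, 2, 3, 4, 6], [0, 1, 3, 5, 6], [0, 2, 3], [1, 2, 3, 4, 6],
       [1, 3, 4], [1, 3, 8]])
    (vectors 9
      [[0, 1, 2, 3, 4, 6, 7], [0, 1, 2, 3, 4, 7], [0, 1, 2, 4, 5, 6, 7], [0, 1, 3, 5, 6, 7],
       [0, 2, 3, 4, 6, 7], [0, 2, 3, 4, 7], [0, 2, 3, 6], [1, 2, 3, 4, 6, 7]])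
    (by decide) (by decide +kernel) (by decide +kernel) (by decide +kernel)
    (by decide +kernel) (by decide +kernel) (by decide +kernel)

theorem IsFree.colorable_seven_of_adj_one_two_three_four (hG : IsFree G) {vs : List V}
    (hvs : vs.Nodup)
    (hM : matrix G vs = matrixOf (extendedCore ++ [[1, 2, 3, 4, 6, 7]])) : G.Colorable 7 :=
  hG.colorable_seven_of_classes hvs hM 8 7
    (vectors 9
      [[0, 2, 4, 5, 6, 7, 8], [0, 2, 4, 5, 7, 8], [0, 2, 5, 6, 7], [0, 2, 5, 6, 7, 8],
       [0, 2, 5, 7, 8], [0, 2, 7, 8], [0, 5, 7, 8]])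
    (vectors 9 [[1, 2, 4, 5, 6, 7], [1, 4, 5, 6, 7], [1, 4, 5, 6, 8], [1, 4, 6]])
    (vectors 9
      [[0, 1, 3, 5, 8], [0, 3, 5, 8], [1, 3, 5, 6], [1, 3, 5, 8], [1, 3, 8], [1, 5, 6, 8]])
    (vectors 9
      [[0, 1, 2, 3, 4], [0, 1, 2, 3, 4, 7], [0, 1, 3, 5, 7], [0, 2, 3], [0, 2, 3, 4, 7],
       [0, 3, 8], [1, 3, 4]])
    (vectors 9
      [[0, 1, 2, 3, 4, 6], [0, 1, 2, 3, 4, 6, 7], [0, 1, 2, 4, 5, 6, 7], [0, 1, 3, 5, 6, 7],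
       [0, 2, 3, 4, 6, 7], [1, 2, 3, 4, 6], [1, 2, 3, 4, 6, 7], [1, 3, 4, 7]])
    (by decide) (by decide +kernel) (by decide +kernel) (by decide +kernel)
    (by decide +kernel) (by decide +kernel) (by decide +kernel)

theorem IsFree.colorable_seven_of_adj_zero_one_two_three_four (hG : IsFree G) {vs : List V}
    (hvs : vs.Nodup)
    (hM : matrix G vs = matrixOf (extendedCore ++ [[0, 1, 2, 3, 4, 6, 7]])) : G.Colorable 7 :=
  hG.colorable_seven_of_classes hvs hM 8 7
    (vectors 9 [[0, 2, 5, 7, 8], [0, 2, 7, 8], [0, 3, 5, 8], [0, 3, 8], [0, 5, 7, 8]])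
    (vectors 9 [[1, 3, 5, 8], [1, 3, 8], [1, 4, 5, 6, 8], [1, 4, 6, 8], [1, 5, 6, 8]])
    (vectors 9
      [[0, 1, 2, 3, 4, 6], [0, 1, 2, 3, 4, 6, 7], [0, 2, 3], [0, 2, 3, 4, 6, 7], [0, 2, 3, 4, 7],
       [0, 2, 3, 6], [0, 2, 5, 6, 7]])
    (vectors 9
      [[0, 1, 2, 3, 4, 7], [1, 2, 3, 4, 6], [1, 2, 3, 4, 6, 7], [1, 3, 4], [1, 3, 4, 7],
       [1, 4, 5, 6, 7]])
    (vectors 9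
      [[0, 1, 2, 3, 4], [0, 1, 2, 4, 5, 6, 7], [0, 1, 3, 5, 6], [0, 1, 3, 5, 6, 7],
       [0, 1, 3, 5, 7]])
    (by decide) (by decide +kernel) (by decide +kernel) (by decide +kernel)
    (by decide +kernel) (by decide +kernel) (by decide +kernel)

theorem nodup_cons_of_row {vs : List V} (hvs : vs.Nodup) {x : V}
    (hx : row G vs x ∉ matrix G vs) : (x :: vs).Nodup :=
  List.nodup_cons.mpr ⟨fun hxv => hx (List.mem_map_of_mem hxv), hvs⟩

theorem IsFree.isBipartiteOn_side (hG : IsFree G) (h7 : ¬ G.Colorable 7) {vs : List V}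
    (hvs : vs.Nodup) (hM : matrix G vs = matrixOf core) :
    IsBipartiteOn G {x | row G vs x ∈ sideVectors} := by
  by_cases hx : ∃ x, row G vs x = indicator 6 [0, 3]
  swap
  · obtain ⟨A, B, hA, hB, hAB⟩ := hG.isBipartiteOn_of_indepCheck hvs hM
      (vectors 6 [[1, 3], [0, 2, 3], [2, 3, 4]])
      (vectors 6 [[1, 3, 4], [0, 2, 3, 4], [1, 2, 3, 4], [0, 1, 2, 3, 4]])
      (by decide +kernel) (by decide +kernel)
    refine ⟨A, B, hA, hB, fun x hxS => hAB ?_⟩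
    have h03 := not_exists.mp hx x
    simp only [sideVectors, vectors, List.map_cons, List.map_nil, List.mem_cons, List.not_mem_nil,
      or_false, Set.mem_ofPred_eq] at hxS ⊢
    tauto
  by_cases hy : ∃ y, row G vs y = indicator 6 [1, 3]
  swap
  · obtain ⟨A, B, hA, hB, hAB⟩ := hG.isBipartiteOn_of_indepCheck hvs hM
      (vectors 6 [[0, 3], [1, 3, 4], [2, 3, 4]])
      (vectors 6 [[0, 2, 3], [0, 2, 3, 4], [1, 2, 3, 4], [0, 1, 2, 3, 4]])
      (by decide +kernel) (by decide +kernel)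
    refine ⟨A, B, hA, hB, fun x hxS => hAB ?_⟩
    have h13 := not_exists.mp hy x
    simp only [sideVectors, vectors, List.map_cons, List.map_nil, List.mem_cons, List.not_mem_nil,
      or_false, Set.mem_ofPred_eq] at hxS ⊢
    tauto
  obtain ⟨x, hx⟩ := hx
  obtain ⟨y, hy⟩ := hy
  have hvx : (x :: vs).Nodup := nodup_cons_of_row hvs (by
    rw [hM, hx]; decide)
  have hMx : matrix G (x :: vs) = matrixOf (core ++ [[0, 3]]) := by
    rw [matrix_cons, hM, hx]; decide
  have hyx : row G (x :: vs) y = indicator 7 [1, 3] := by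
    have h := hG.row_of_rowCheck hvx hMx
      (p := fun t => !decide (t.drop 1 = indicator 6 [1, 3]) || decide (t = indicator 7 [1, 3]))
      (by decide +kernel) y
    classical
    rw [row_cons, hy] at h ⊢
    revert h
    generalize decide (G.Adj y x) = b
    revert b
    decide
  have hvy : (y :: x :: vs).Nodup := nodup_cons_of_row hvx (by
    rw [hMx, hyx]; decide)
  have hMy : matrix G (y :: x :: vs) = matrixOf extendedCore := by
    rw [matrix_cons, hMx, hyx]; decide
  have hw (S : List ℕ) (z : V) (hz : row G (y :: x :: vs) z = indicator 8 S)
      (hS : indicator 8 S ∉ matrixOf extendedCore) :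
      (z :: y :: x :: vs).Nodup ∧ matrix G (z :: y :: x :: vs) =
        border (matrixOf extendedCore) (indicator 8 S) :=
    ⟨nodup_cons_of_row hvy (by rwa [hMy, hz]), by
      rw [matrix_cons, hMy, hz]⟩
  obtain ⟨A, B, hA, hB, hAB⟩ := hG.isBipartiteOn_of_indepCheck hvy hMy
    (vectors 8 [[2, 3, 4], [1, 3], [0, 2, 3], [0, 2, 3, 6], [1, 2, 3, 4, 6], [0, 1, 2, 3, 4],
      [0, 1, 2, 3, 4, 6]])
    (vectors 8 [[0, 3], [1, 3, 4], [1, 3, 4, 7], [0, 2, 3, 4, 7], [0, 1, 2, 3, 4, 7]])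
    (by decide +kernel) (by decide +kernel)
  refine ⟨A, B, hA, hB, fun z hzS => hAB ?_⟩
  have hz := hG.row_of_rowCheck hvy hMy (p := fun t =>
      !decide (t.drop 2 ∈ sideVectors) ||
      decide ((t ∈ vectors 8 [[2, 3, 4], [1, 3], [0, 2, 3], [0, 2, 3, 6], [1, 2, 3, 4, 6],
        [0, 1, 2, 3, 4], [0, 1, 2, 3, 4, 6]] ∨
      t ∈ vectors 8 [[0, 3], [1, 3, 4], [1, 3, 4, 7], [0, 2, 3, 4, 7], [0, 1, 2, 3, 4, 7]]) ∨
      t = indicator 8 [0, 2, 3, 4, 6, 7] ∨ t = indicator 8 [1, 2, 3, 4, 6, 7] ∨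
      t = indicator 8 [0, 1, 2, 3, 4, 6, 7])) (by decide +kernel) z
  have hdrop : (row G (y :: x :: vs) z).drop 2 = row G vs z := by simp [row]
  have hzS' : row G vs z ∈ sideVectors := hzS
  rw [hdrop, decide_eq_true hzS', Bool.not_true, Bool.false_or, decide_eq_true_eq] at hz
  rcases hz with hz | hz | hz | hz
  · exact hz
  · obtain ⟨hn, hm⟩ := hw _ z hz (by decide)
    exact (h7 (hG.colorable_seven_of_adj_zero_two_three_four hn (hm.trans (by decide)))).elim
  · obtain ⟨hn, hm⟩ := hw _ z hz (by decide)
    exact (h7 (hG.colorable_seven_of_adj_one_two_three_four hn (hm.trans (by decide)))).elim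
  · obtain ⟨hn, hm⟩ := hw _ z hz (by decide)
    exact (h7 (hG.colorable_seven_of_adj_zero_one_two_three_four hn (hm.trans (by decide)))).elim

/-- Relabel a vector over the core by the automorphism exchanging the vertices `3` and `5`. -/
def swapVector (t : List Bool) : List Bool := [2, 1, 0, 3, 4, 5].map fun i => t.getD i false

theorem IsFree.colorable_seven_of_core (hG : IsFree G) {a b c d e f : V}
    (hvs : [f, e, d, c, b, a].Nodup) (hM : matrix G [f, e, d, c, b, a] = matrixOf core) :
    G.Colorable 7 := by
  by_contra h7
  have hrow (x : V) : row G [d, e, f, c, b, a] x = swapVector (row G [f, e, d, c, b, a] x) := rfl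
  have hM' : matrix G [d, e, f, c, b, a] = matrixOf core := by
    have : matrix G [d, e, f, c, b, a] =
        [2, 1, 0, 3, 4, 5].map fun i => swapVector ((matrix G [f, e, d, c, b, a]).getD i []) := rfl
    rw [this, hM]
    decide
  have hvs' : [d, e, f, c, b, a].Nodup := by
    simp only [List.nodup_cons, List.mem_cons, List.not_mem_nil, or_false, not_or,
      not_false_eq_true, List.nodup_nil, and_true] at hvs ⊢
    grind
  have hfd : G.Adj d f := by
    have : ((matrix G [f, e, d, c, b, a]).getD 2 []).getD 0 false = true := by rw [hM]; decide
    simpa [matrix, row] using this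
  refine h7 (colorable_seven_of_cover (hG.isBipartiteOn_nonneighbors hfd)
    (hG.isBipartiteOn_side h7 hvs hM) (hG.isBipartiteOn_side h7 hvs' hM')
    (hG.isIndepSet_of_indepCheck hvs hM
      (L := vectors 6 [[0, 3, 5], [1, 3, 5], [0, 1, 3, 5]]) (by decide +kernel)) fun x => ?_)
  have hx := hG.row_of_rowCheck hvs hM (p := fun t => !t.getD 2 false && !t.getD 0 false ||
    decide (t ∈ sideVectors ∨ swapVector t ∈ sideVectors ∨
      t ∈ vectors 6 [[0, 3, 5], [1, 3, 5], [0, 1, 3, 5]])) (by decide +kernel) x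
  rw [Bool.or_eq_true, Bool.and_eq_true, Bool.not_eq_true', Bool.not_eq_true', decide_eq_true_eq,
    Bool.eq_false_iff, Bool.eq_false_iff, ne_eq, ne_eq, getD_row (by simp), getD_row (by simp),
    ← hrow] at hx
  exact hx

end

theorem chromatic_le_seven_of_coTwinC5 {V : Type*} [Fintype V] (G : SimpleGraph V)
    (hP : ¬ Contains G P3P2) (hK : ¬ Contains G (completeGraph (Fin 4)))
    (hK3P2 : ¬ Contains G K3P2) (hD : ¬ Contains G coDomino)
    (hX1 : ¬ Contains G X1) (hX2 : ¬ Contains G X2)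
    (h : Contains G coTwinC5) :
    G.chromaticNumber ≤ 7 := by
  have hG : IsFree G := ⟨hP, hK, hK3P2, hD, hX1, hX2⟩
  obtain ⟨φ⟩ := h
  refine Colorable.chromaticNumber_le (hG.colorable_seven_of_core (a := φ 0) (b := φ 1)
    (c := φ 2) (d := φ 3) (e := φ 4) (f := φ 5) ?_ ?_)
  · exact List.Nodup.map (f := φ) (l := [5, 4, 3, 2, 1, 0]) φ.injective (by decide)
  · classical
    have hadj (i j : Fin 6) : decide (G.Adj (φ i) (φ j)) =
        ((matrixOf core).getD (5 - i) []).getD (5 - j) false := by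
      rw [Bool.eq_iff_iff, decide_eq_true_iff, φ.map_rel_iff]
      revert i j
      simp only [coTwinC5, fromEdgeSet_adj]
      decide
    simp only [matrix, row, List.map_cons, List.map_nil, hadj]
    decide
end
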